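/- There exists a universal constant C > 0 such that for every n, every r ≥ 2, every isotropic log-concave random vector X in ℝⁿ, and every t ≥ 1, one has P(‖X‖_r ≥ C·t·r·n^{1/r}) ≤ exp(−σ_X^{−1}(t·r·n^{1/r})), where ‖x‖_r := (∑_{i=1}^n |x_i|^r)^{1/r}. -/

import Mathlib

open MeasureTheory ProbabilityTheory Real
open scoped Pointwise ENNReal RealInnerProductSpace

noncomputable section

variable {Ω : Type*} [MeasurableSpace Ω]

/-- A random vector `X` in `ℝⁿ` is log-concave: for all nonempty compact sets `K, L` and
`a ∈ [0,1]`, `P(X ∈ aK + (1-a)L) ≥ P(X ∈ K)^a * P(X ∈ L)^(1-a)`. -/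
def IsLogConcave {n : ℕ} (μ : Measure Ω) (X : Ω → EuclideanSpace ℝ (Fin n)) : Prop :=
  ∀ K L : Set (EuclideanSpace ℝ (Fin n)), K.Nonempty → L.Nonempty →
    IsCompact K → IsCompact L → ∀ a : ℝ, 0 ≤ a → a ≤ 1 →
      (μ (X ⁻¹' K)).toReal ^ a * (μ (X ⁻¹' L)).toReal ^ (1 - a) ≤
        (μ (X ⁻¹' (a • K + (1 - a) • L))).toReal

/-- `X` is isotropic: centered with identity covariance matrix. -/
def IsIsotropic {n : ℕ} (μ : Measure Ω) (X : Ω → EuclideanSpace ℝ (Fin n)) : Prop :=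
  (∀ i, ∫ ω, X ω i ∂μ = 0) ∧
  ∀ i j, ∫ ω, X ω i * X ω j ∂μ = if i = j then (1 : ℝ) else 0

/-- `σ_X(p) = sup_{|t| = 1} (E|⟨t,X⟩|^p)^(1/p)`. -/
def sigmaX {n : ℕ} (μ : Measure Ω) (X : Ω → EuclideanSpace ℝ (Fin n)) (p : ℝ) : ℝ :=
  ⨆ t : {t : EuclideanSpace ℝ (Fin n) // ‖t‖ = 1},
    (∫ ω, |⟪t.1, X ω⟫| ^ p ∂μ) ^ (1 / p)

/-- Generalized inverse of `σ_X`. -/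
def sigmaXInv {n : ℕ} (μ : Measure Ω) (X : Ω → EuclideanSpace ℝ (Fin n)) (s : ℝ) : ℝ :=
  sSup {p : ℝ | 1 ≤ p ∧ sigmaX μ X p ≤ s}

/-- The `l_r`-norm `‖x‖_r = (∑ᵢ |xᵢ|^r)^(1/r)`. -/
def lrNorm {n : ℕ} (r : ℝ) (x : EuclideanSpace ℝ (Fin n)) : ℝ :=
  (∑ i, |x i| ^ r) ^ (1 / r)

/-- Log-concavity of a measure, tested on measurable sets. -/
def LogConcMeas {V : Type*} [AddCommGroup V] [Module ℝ V] [MeasurableSpace V]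
    (μ : Measure V) : Prop :=
  ∀ A B C : Set V, MeasurableSet A → MeasurableSet B → MeasurableSet C →
    ∀ a : ℝ, 0 < a → a < 1 → (∀ x ∈ A, ∀ y ∈ B, a • x + (1 - a) • y ∈ C) →
      μ.real A ^ a * μ.real B ^ (1 - a) ≤ μ.real C

section LogConc

variable {V : Type*} [NormedAddCommGroup V] [InnerProductSpace ℝ V]
  [MeasurableSpace V] [BorelSpace V]

lemma exists_compact_seq_tendsto [FiniteDimensional ℝ V] (μ : Measure V) [IsFiniteMeasure μ]
    {A : Set V} (hA : MeasurableSet A) :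
    ∃ K : ℕ → Set V, (∀ k, IsCompact (K k) ∧ K k ⊆ A) ∧
      Filter.Tendsto (fun k => μ.real (K k)) Filter.atTop (nhds (μ.real A)) := by
  have h : ∀ k : ℕ, ∃ K ⊆ A, IsCompact K ∧ μ.real A - 1 / ((k : ℝ) + 1) ≤ μ.real K := by
    intro k
    have hk : (0 : ℝ) < 1 / ((k : ℝ) + 1) := by positivity
    obtain ⟨K, hKA, hK, hlt⟩ := hA.exists_isCompact_lt_add (measure_ne_top μ A)
      (ε := ENNReal.ofReal (1 / ((k : ℝ) + 1))) (by simpa using hk)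
    refine ⟨K, hKA, hK, ?_⟩
    have h1 := ENNReal.toReal_mono (by finiteness) hlt.le
    rw [ENNReal.toReal_add (by finiteness) (by finiteness), ENNReal.toReal_ofReal hk.le] at h1
    simp only [Measure.real]
    linarith
  choose K hKA hK hle using h
  refine ⟨K, fun k => ⟨hK k, hKA k⟩, ?_⟩
  refine tendsto_of_tendsto_of_tendsto_of_le_of_le ?_ tendsto_const_nhds hle
    (fun k => measureReal_mono (hKA k))
  simpa using tendsto_const_nhds.sub (tendsto_one_div_add_atTop_nhds_zero_nat (𝕜 := ℝ))

lemma IsLogConcave.logConcMeas {n : ℕ} {μ : Measure Ω} [IsProbabilityMeasure μ]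
    {X : Ω → EuclideanSpace ℝ (Fin n)} (hX : Measurable X) (h : IsLogConcave μ X) :
    LogConcMeas (μ.map X) := by
  intro A B C hA hB hC a ha0 ha1 hABC
  have : IsProbabilityMeasure (μ.map X) := Measure.isProbabilityMeasure_map hX.aemeasurable
  obtain ⟨K, hK, hKt⟩ := exists_compact_seq_tendsto (μ.map X) hA
  obtain ⟨L, hL, hLt⟩ := exists_compact_seq_tendsto (μ.map X) hB
  have hlim : Filter.Tendsto
      (fun k => (μ.map X).real (K k) ^ a * (μ.map X).real (L k) ^ (1 - a)) Filter.atTop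
      (nhds ((μ.map X).real A ^ a * (μ.map X).real B ^ (1 - a))) :=
    (hKt.rpow_const (Or.inr ha0.le)).mul (hLt.rpow_const (Or.inr (by linarith)))
  refine le_of_tendsto' hlim fun k => ?_
  obtain ⟨hKc, hKA⟩ := hK k
  obtain ⟨hLc, hLB⟩ := hL k
  rcases (K k).eq_empty_or_nonempty with h0 | hKn
  · simp [h0, Real.zero_rpow ha0.ne']
  rcases (L k).eq_empty_or_nonempty with h0 | hLn
  · simp [h0, Real.zero_rpow (by linarith : (1 : ℝ) - a ≠ 0)]
  have h1 := h _ _ hKn hLn hKc hLc a ha0.le ha1.le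
  simp only [map_measureReal_apply hX hKc.measurableSet, map_measureReal_apply hX hLc.measurableSet,
    map_measureReal_apply hX hC]
  refine h1.trans (measureReal_mono (Set.preimage_mono ?_))
  rintro _ ⟨_, ⟨x, hx, rfl⟩, _, ⟨y, hy, rfl⟩, rfl⟩
  exact hABC x (hKA hx) y (hLB hy)

lemma LogConcMeas.map {W : Type*} [NormedAddCommGroup W] [NormedSpace ℝ W]
    [MeasurableSpace W] [BorelSpace W] {μ : Measure V} (h : LogConcMeas μ) (L : V →L[ℝ] W) :
    LogConcMeas (μ.map L) := by
  intro A B C hA hB hC a ha0 ha1 hABC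
  have hL : Measurable L := L.continuous.measurable
  simp only [map_measureReal_apply hL hA, map_measureReal_apply hL hB, map_measureReal_apply hL hC]
  refine h _ _ _ (hL hA) (hL hB) (hL hC) a ha0 ha1 fun x hx y hy => ?_
  simpa using hABC _ hx _ hy

lemma LogConcMeas.cond {E : Type*} [AddCommGroup E] [Module ℝ E] [MeasurableSpace E]
    {μ : Measure E} [IsProbabilityMeasure μ] (h : LogConcMeas μ) {Q : Set E}
    (hQ : MeasurableSet Q) (hc : Convex ℝ Q) : LogConcMeas μ[|Q] := by
  intro A B C hA hB hC a ha0 ha1 hABC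
  have hap : ∀ S : Set E, μ[|Q].real S = (μ.real Q)⁻¹ * μ.real (Q ∩ S) := fun S => by
    simp [Measure.real, cond_apply hQ, ENNReal.toReal_mul]
  simp only [hap]
  have hq : 0 ≤ (μ.real Q)⁻¹ := by positivity
  rcases hq.eq_or_lt with h0 | h0
  · simp [← h0, Real.zero_rpow ha0.ne']
  rw [Real.mul_rpow hq measureReal_nonneg, Real.mul_rpow hq measureReal_nonneg]
  calc _ = (μ.real Q)⁻¹ ^ a * (μ.real Q)⁻¹ ^ (1 - a) *
        (μ.real (Q ∩ A) ^ a * μ.real (Q ∩ B) ^ (1 - a)) := by ring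
    _ = (μ.real Q)⁻¹ * (μ.real (Q ∩ A) ^ a * μ.real (Q ∩ B) ^ (1 - a)) := by
        rw [← Real.rpow_add h0]; simp
    _ ≤ _ := by
        gcongr
        refine h _ _ _ (hQ.inter hA) (hQ.inter hB) (hQ.inter hC) a ha0 ha1 fun x hx y hy => ?_
        exact ⟨hc hx.1 hy.1 ha0.le (by linarith) (by ring), hABC _ hx.2 _ hy.2⟩

/-- Borell's lemma. -/
lemma LogConcMeas.borell {W : Type*} [NormedAddCommGroup W] [NormedSpace ℝ W]
    {ν : Measure V} [IsProbabilityMeasure ν] (h : LogConcMeas ν) (L : V →L[ℝ] W) {θ : ℝ}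
    (hν : ν.real {x | θ < ‖L x‖} ≤ 1 / 4) (t : ℝ) :
    ν.real {x | t * θ < ‖L x‖} ≤ 2 * exp (-t / 2) := by
  rcases le_or_gt t 1 with ht | ht
  · have h1 := Real.add_one_le_exp (-t / 2)
    have h2 : ν.real {x | t * θ < ‖L x‖} ≤ 1 := measureReal_le_one
    linarith
  have hcont : Continuous fun x => ‖L x‖ := by fun_prop
  have hms : ∀ s : ℝ, MeasurableSet {x | s < ‖L x‖} := fun s =>
    (isOpen_lt continuous_const hcont).measurableSet
  set a : ℝ := 2 / (t + 1) with ha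
  have ha0 : 0 < a := by positivity
  have ha1 : a < 1 := by rw [ha, div_lt_one (by linarith)]; linarith
  have hat : a * (t + 1) = 2 := by rw [ha]; field_simp
  have key := h _ _ _ (hms (t * θ)) (hms θ).compl (hms θ) a ha0 ha1 (by
    intro x hx y hy
    simp only [Set.mem_ofPred_eq, Set.mem_compl_iff, not_lt] at hx hy ⊢
    have e1 : ‖a • L x‖ ≤ ‖L (a • x + (1 - a) • y)‖ + ‖(1 - a) • L y‖ := by
      have : a • L x = L (a • x + (1 - a) • y) - (1 - a) • L y := by simp
      rw [this]; exact norm_sub_le _ _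
    rw [norm_smul, norm_smul, Real.norm_of_nonneg ha0.le, Real.norm_of_nonneg (by linarith)] at e1
    have e2 : a * (t * θ) < a * ‖L x‖ := by gcongr
    have e3 : (1 - a) * ‖L y‖ ≤ (1 - a) * θ := by gcongr
    have e4 : a * (t * θ) - (1 - a) * θ = θ := by linear_combination θ * hat
    linarith)
  rw [probReal_compl_eq_one_sub (hms θ)] at key
  set q := ν.real {x | θ < ‖L x‖}
  set P := ν.real {x | t * θ < ‖L x‖}
  have hP0 : 0 ≤ P := measureReal_nonneg
  have hq0 : 0 ≤ q := measureReal_nonneg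
  have h1 : (3 / 4 : ℝ) ≤ (1 - q) ^ (1 - a) := by
    calc (3 / 4 : ℝ) ≤ 1 - q := by linarith
      _ = (1 - q) ^ (1 : ℝ) := by simp
      _ ≤ _ := Real.rpow_le_rpow_of_exponent_ge (by linarith) (by linarith) (by linarith)
  have h2 : P ^ a ≤ 1 / 3 := by
    have : P ^ a * (3 / 4) ≤ 1 / 4 := by
      calc P ^ a * (3 / 4) ≤ P ^ a * (1 - q) ^ (1 - a) := by gcongr
        _ ≤ _ := key.trans hν
    linarith
  have h3 : P ^ a ≤ exp (-1) := by
    rw [Real.exp_neg]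
    refine h2.trans ?_
    rw [one_div]
    gcongr
    exact Real.exp_one_lt_three.le
  have h4 : P ≤ exp (-(t + 1) / 2) := by
    have : (P ^ a) ^ (a⁻¹) ≤ exp (-1) ^ (a⁻¹) := by gcongr
    rw [← Real.rpow_mul hP0, mul_inv_cancel₀ ha0.ne', Real.rpow_one, ← Real.exp_mul] at this
    convert this using 2
    rw [ha]; field_simp
  refine h4.trans ?_
  have : exp (-(t + 1) / 2) ≤ exp (-t / 2) := by gcongr; linarith
  linarith [Real.exp_pos (-t / 2)]

/-- Exponential tails under a second moment bound. -/
lemma LogConcMeas.tail_of_sq {W : Type*} [NormedAddCommGroup W] [NormedSpace ℝ W]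
    {ν : Measure V} [IsProbabilityMeasure ν] (h : LogConcMeas ν) (L : V →L[ℝ] W) {b : ℝ}
    (hb : 0 < b) (hν : ∫⁻ x, ENNReal.ofReal (‖L x‖ ^ 2) ∂ν ≤ ENNReal.ofReal (b ^ 2)) (t : ℝ) :
    ν.real {x | t * b < ‖L x‖} ≤ 2 * exp (-t / 4) := by
  have hcont : Continuous fun x => ‖L x‖ := by fun_prop
  have h1 : ν.real {x | 2 * b < ‖L x‖} ≤ 1 / 4 := by
    have h2 : ENNReal.ofReal ((2 * b) ^ 2) * ν {x | 2 * b < ‖L x‖} ≤ ENNReal.ofReal (b ^ 2) := by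
      refine le_trans ?_ (le_trans (mul_meas_ge_le_lintegral₀ (μ := ν)
        (f := fun x => ENNReal.ofReal (‖L x‖ ^ 2))
        ((hcont.pow 2).measurable.ennreal_ofReal.aemeasurable)
        (ENNReal.ofReal ((2 * b) ^ 2))) hν)
      gcongr
      rintro (hx : 2 * b < ‖L _‖)
      exact ENNReal.ofReal_le_ofReal (by gcongr)
    have h3 := ENNReal.toReal_mono (by finiteness) h2
    rw [ENNReal.toReal_mul, ENNReal.toReal_ofReal (by positivity),
      ENNReal.toReal_ofReal (by positivity)] at h3
    have h4 : 0 < b ^ 2 := by positivity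
    have h5 : b ^ 2 * (4 * ν.real {x | 2 * b < ‖L x‖}) ≤ b ^ 2 * 1 := by
      simp only [Measure.real]; linarith
    have := le_of_mul_le_mul_left h5 h4
    linarith
  have := h.borell L h1 (t / 2)
  convert this using 2
  · ring_nf
  · ring_nf

end LogConc

lemma rpow_mul_exp_le {q β t : ℝ} (hq : 1 ≤ q) (hβ : 0 < β) (ht : 0 ≤ t) :
    t ^ (q - 1) * exp (-t / β) ≤ (2 * β * q) ^ (q - 1) * exp (-t / (2 * β)) := by
  set s : ℝ := t / (2 * β * q) with hs
  have hs0 : 0 ≤ s := by positivity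
  have hts : t = 2 * β * q * s := by rw [hs]; field_simp
  have h1 : s ^ (q - 1) ≤ exp (t / (2 * β)) := by
    calc s ^ (q - 1) ≤ exp s ^ (q - 1) :=
          Real.rpow_le_rpow hs0 (by linarith [Real.add_one_le_exp s]) (by linarith)
      _ = exp (s * (q - 1)) := by rw [← Real.exp_mul]
      _ ≤ exp (t / (2 * β)) := by
          gcongr
          have : t / (2 * β) = s * q := by rw [hs]; field_simp
          rw [this]; nlinarith
  have h2 : t ^ (q - 1) = (2 * β * q) ^ (q - 1) * s ^ (q - 1) := by
    rw [← Real.mul_rpow (by positivity) hs0, ← hts]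
  have h3 : exp (-t / (2 * β)) = exp (t / (2 * β)) * exp (-t / β) := by
    rw [← Real.exp_add]; congr 1; field_simp; ring
  rw [h2, h3, mul_assoc]
  gcongr

lemma lintegral_exp_neg_div {c : ℝ} (hc : 0 < c) :
    ∫⁻ t in Set.Ioi (0 : ℝ), ENNReal.ofReal (exp (-t / c)) = ENNReal.ofReal c := by
  have h : ∀ t : ℝ, -t / c = (-c⁻¹) * t := fun t => by field_simp
  simp only [h]
  rw [← ofReal_integral_eq_lintegral_ofReal]
  · rw [integral_exp_mul_Ioi (by simpa using hc)]
    simp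
  · exact integrableOn_exp_mul_Ioi (by simpa using hc) 0
  · exact Filter.Eventually.of_forall fun t => (Real.exp_pos _).le

/-- Moment-type integrals of exponentially decaying functions. -/
lemma lintegral_rpow_mul_le_of_exp_decay {G : ℝ → ℝ} {D q β : ℝ} (hD : 0 ≤ D) (hq : 1 ≤ q)
    (hβ : 0 < β) (hG : ∀ t, 0 < t → G t ≤ D * exp (-t / β)) :
    ENNReal.ofReal q * ∫⁻ t in Set.Ioi (0 : ℝ), ENNReal.ofReal (G t) * ENNReal.ofReal (t ^ (q - 1))
      ≤ ENNReal.ofReal (D * (2 * β * q) ^ q) := by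
  have h1 : ∫⁻ t in Set.Ioi (0 : ℝ), ENNReal.ofReal (G t) * ENNReal.ofReal (t ^ (q - 1)) ≤
      ∫⁻ t in Set.Ioi (0 : ℝ), ENNReal.ofReal (D * (2 * β * q) ^ (q - 1)) *
        ENNReal.ofReal (exp (-t / (2 * β))) := by
    refine setLIntegral_mono (by fun_prop) fun t (ht : 0 < t) => ?_
    rw [← ENNReal.ofReal_mul' (by positivity), ← ENNReal.ofReal_mul (by positivity)]
    refine ENNReal.ofReal_le_ofReal ?_
    calc G t * t ^ (q - 1) ≤ D * exp (-t / β) * t ^ (q - 1) := by gcongr; exact hG t ht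
      _ = D * (t ^ (q - 1) * exp (-t / β)) := by ring
      _ ≤ D * ((2 * β * q) ^ (q - 1) * exp (-t / (2 * β))) := by
          gcongr D * ?_; exact rpow_mul_exp_le hq hβ ht.le
      _ = _ := by ring
  rw [lintegral_const_mul _ (by fun_prop), lintegral_exp_neg_div (by positivity)] at h1
  calc _ ≤ ENNReal.ofReal q * (ENNReal.ofReal (D * (2 * β * q) ^ (q - 1)) *
        ENNReal.ofReal (2 * β)) := by gcongr
    _ = _ := by
      rw [← ENNReal.ofReal_mul (by positivity), ← ENNReal.ofReal_mul (by positivity)]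
      congr 1
      rw [Real.rpow_sub_one (by positivity)]
      field_simp

lemma lintegral_rpow_le_of_exp_tail {α : Type*} [MeasurableSpace α] {ν : Measure α}
    [IsFiniteMeasure ν] {g : α → ℝ} (hg : Measurable g) (hg0 : ∀ x, 0 ≤ g x) {D q β : ℝ}
    (hD : 0 ≤ D) (hq : 1 ≤ q) (hβ : 0 < β)
    (h : ∀ t, 0 < t → ν.real {x | t < g x} ≤ D * exp (-t / β)) :
    ∫⁻ x, ENNReal.ofReal (g x ^ q) ∂ν ≤ ENNReal.ofReal (D * (2 * β * q) ^ q) := by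
  rw [lintegral_rpow_eq_lintegral_meas_lt_mul ν (Filter.Eventually.of_forall hg0) hg.aemeasurable
    (by linarith)]
  refine le_trans (le_of_eq ?_) (lintegral_rpow_mul_le_of_exp_decay hD hq hβ h)
  simp

/-- Reverse Hölder inequality for linear functionals of log-concave measures. -/
lemma LogConcMeas.moment_le {V W : Type*} [NormedAddCommGroup V] [InnerProductSpace ℝ V]
    [MeasurableSpace V] [BorelSpace V] [NormedAddCommGroup W] [NormedSpace ℝ W]
    {ν : Measure V} [IsProbabilityMeasure ν] (h : LogConcMeas ν) (L : V →L[ℝ] W) {b q : ℝ}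
    (hb : 0 < b) (hν : ∫⁻ x, ENNReal.ofReal (‖L x‖ ^ 2) ∂ν ≤ ENNReal.ofReal (b ^ 2))
    (hq : 1 ≤ q) :
    ∫⁻ x, ENNReal.ofReal (‖L x‖ ^ q) ∂ν ≤ ENNReal.ofReal ((16 * b * q) ^ q) := by
  have hcont : Continuous fun x => ‖L x‖ := by fun_prop
  refine (lintegral_rpow_le_of_exp_tail (D := 2) (β := 4 * b) hcont.measurable
    (fun _ => norm_nonneg _) (by norm_num) hq (by positivity) fun t _ => ?_).trans ?_
  · have := h.tail_of_sq L hb hν (t / b)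
    rw [div_mul_cancel₀ _ hb.ne'] at this
    convert this using 3
    field_simp
  · refine ENNReal.ofReal_le_ofReal ?_
    have : (16 * b * q) ^ q = 2 ^ q * (2 * (4 * b) * q) ^ q := by
      rw [← Real.mul_rpow (by positivity) (by positivity)]; ring_nf
    rw [this]
    gcongr
    exact Real.self_le_rpow_of_one_le (by norm_num) hq

section Gaussian

variable {V : Type*} [NormedAddCommGroup V] [InnerProductSpace ℝ V] [FiniteDimensional ℝ V]
  [MeasurableSpace V] [BorelSpace V]

lemma integral_exp_neg_mul_sq_gaussianReal {v : NNReal} (hv : v ≠ 0) {l : ℝ} (hl : 0 < l) :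
    ∫ x, exp (-l * x ^ 2) ∂(gaussianReal 0 v) = (√(1 + 2 * l * v))⁻¹ := by
  have hv' : (0 : ℝ) < v := by positivity
  rw [integral_gaussianReal_eq_integral_smul hv]
  have h : ∀ x : ℝ, gaussianPDFReal 0 v x • exp (-l * x ^ 2) =
      (√(2 * π * v))⁻¹ * exp (-(l + 1 / (2 * v)) * x ^ 2) := by
    intro x
    rw [gaussianPDFReal_def, smul_eq_mul, mul_assoc, ← Real.exp_add]
    congr 2
    field_simp
    ring
  simp_rw [h]
  rw [integral_const_mul, integral_gaussian, ← Real.sqrt_inv, ← Real.sqrt_inv,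
    ← Real.sqrt_mul (by positivity)]
  congr 1
  field_simp
  ring

lemma map_inner_stdGaussian (z : V) :
    (stdGaussian V).map (fun x => ⟪x, z⟫) = gaussianReal 0 (‖z‖ ^ 2).toNNReal := by
  have h := IsGaussian.map_eq_gaussianReal (μ := stdGaussian V) (innerSL ℝ z)
  rw [integral_strongDual_stdGaussian, variance_dual_stdGaussian, innerSL_apply_norm] at h
  convert h using 2
  ext x
  simp [real_inner_comm]

lemma lintegral_inner_sq_stdGaussian (z : V) :
    ∫⁻ x, ENNReal.ofReal (⟪x, z⟫ ^ 2) ∂(stdGaussian V) = ENNReal.ofReal (‖z‖ ^ 2) := by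
  have h2 : evariance (fun x : ℝ => x) (gaussianReal 0 (‖z‖ ^ 2).toNNReal) =
      ENNReal.ofReal (‖z‖ ^ 2) := by
    rw [← ofReal_variance (by exact memLp_id_gaussianReal 2), variance_fun_id_gaussianReal,
      Real.coe_toNNReal _ (by positivity)]
  rw [evariance_eq_lintegral_ofReal, ← map_inner_stdGaussian,
    lintegral_map (by fun_prop) (by fun_prop)] at h2
  rw [← h2, map_inner_stdGaussian]
  simp

/-- Second moment of a Gaussian matrix applied to a vector. -/
lemma lintegral_sum_inner_sq_pi (m : ℕ) (z : V) :
    ∫⁻ g : Fin m → V, ENNReal.ofReal (∑ j, ⟪g j, z⟫ ^ 2) ∂(Measure.pi fun _ => stdGaussian V) =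
      ENNReal.ofReal (m * ‖z‖ ^ 2) := by
  have h1 : ∀ g : Fin m → V, ENNReal.ofReal (∑ j, ⟪g j, z⟫ ^ 2) =
      ∑ j, ENNReal.ofReal (⟪g j, z⟫ ^ 2) := fun g =>
    ENNReal.ofReal_sum_of_nonneg fun _ _ => sq_nonneg _
  simp_rw [h1]
  rw [lintegral_finsetSum _ (fun j _ => by fun_prop)]
  have h2 : ∀ j : Fin m, ∫⁻ g : Fin m → V, ENNReal.ofReal (⟪g j, z⟫ ^ 2)
      ∂(Measure.pi fun _ => stdGaussian V) = ENNReal.ofReal (‖z‖ ^ 2) := by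
    intro j
    have hmp := measurePreserving_eval (fun _ : Fin m => stdGaussian V) j
    rw [← lintegral_inner_sq_stdGaussian z]
    exact hmp.lintegral_comp (f := fun x => ENNReal.ofReal (⟪x, z⟫ ^ 2)) (by fun_prop)
  simp [h2, ENNReal.ofReal_mul]

/-- Small ball estimate for a Gaussian matrix applied to a vector. -/
lemma small_ball_pi (m : ℕ) {z : V} (hz : z ≠ 0) {ε : ℝ} (hε : 0 < ε) :
    (Measure.pi fun _ : Fin m => stdGaussian V).real
      {g | ∑ j, ⟪g j, z⟫ ^ 2 ≤ ε ^ 2 * m * ‖z‖ ^ 2} ≤ (exp 1 * ε) ^ m := by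
  have hz' : 0 < ‖z‖ := norm_pos_iff.2 hz
  set P := (Measure.pi fun _ : Fin m => stdGaussian V)
  set l : ℝ := 1 / (ε ^ 2 * ‖z‖ ^ 2) with hl
  have hl0 : 0 < l := by positivity
  set f : (Fin m → V) → ℝ := fun g => ∏ j, exp (-l * ⟪g j, z⟫ ^ 2) with hf
  have hf' : ∀ g, f g = exp (-l * ∑ j, ⟪g j, z⟫ ^ 2) := fun g => by
    simp only [hf]
    rw [← Real.exp_sum, Finset.mul_sum]
  have h_int_le : ∫ x, exp (-l * ⟪x, z⟫ ^ 2) ∂(stdGaussian V) ≤ ε := by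
    have h1 : ∫ x, exp (-l * ⟪x, z⟫ ^ 2) ∂(stdGaussian V) =
        ∫ y, exp (-l * y ^ 2) ∂((stdGaussian V).map (fun x => ⟪x, z⟫)) := by
      rw [integral_map (by fun_prop) (Measurable.aestronglyMeasurable (by fun_prop))]
    rw [h1, map_inner_stdGaussian, integral_exp_neg_mul_sq_gaussianReal (by positivity) hl0,
      Real.coe_toNNReal _ (by positivity)]
    rw [inv_le_comm₀ (by positivity) hε]
    apply Real.le_sqrt_of_sq_le
    have : l * ‖z‖ ^ 2 = (ε⁻¹) ^ 2 := by rw [hl]; field_simp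
    nlinarith [sq_nonneg ε⁻¹]
  have h_int : ∫ g, f g ∂P ≤ ε ^ m := by
    rw [hf, integral_fintype_prod_eq_prod (f := fun (_ : Fin m) (x : V) => exp (-l * ⟪x, z⟫ ^ 2))]
    rw [Finset.prod_const, Finset.card_univ, Fintype.card_fin]
    exact pow_le_pow_left₀ (integral_nonneg fun _ => (Real.exp_pos _).le) h_int_le m
  have hfi : Integrable f P := by
    refine Integrable.of_bound (Measurable.aestronglyMeasurable (by fun_prop)) 1
      (Filter.Eventually.of_forall fun g => ?_)
    rw [hf', Real.norm_of_nonneg (Real.exp_pos _).le, Real.exp_le_one_iff, neg_mul,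
      neg_nonpos]
    exact mul_nonneg hl0.le (Finset.sum_nonneg fun _ _ => sq_nonneg _)
  have hmk := mul_meas_ge_le_integral_of_nonneg (μ := P) (f := f)
    (Filter.Eventually.of_forall fun g => by rw [hf']; exact (Real.exp_pos _).le) hfi (exp (-m))
  have hsub : P.real {g | ∑ j, ⟪g j, z⟫ ^ 2 ≤ ε ^ 2 * m * ‖z‖ ^ 2} ≤
      P.real {g | exp (-m) ≤ f g} := by
    refine measureReal_mono ?_
    intro g hg
    have hg : ∑ j, ⟪g j, z⟫ ^ 2 ≤ ε ^ 2 * m * ‖z‖ ^ 2 := hg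
    change exp (-m) ≤ f g
    rw [hf']
    gcongr
    have : l * (ε ^ 2 * m * ‖z‖ ^ 2) = m := by rw [hl]; field_simp
    have := mul_le_mul_of_nonneg_left hg hl0.le
    linarith
  have h3 : exp (-m) * P.real {g | ∑ j, ⟪g j, z⟫ ^ 2 ≤ ε ^ 2 * m * ‖z‖ ^ 2} ≤ ε ^ m :=
    (mul_le_mul_of_nonneg_left hsub (Real.exp_pos _).le).trans (hmk.trans h_int)
  rw [mul_pow, ← Real.exp_nat_mul, mul_one]
  calc _ = exp m * (exp (-m) * P.real {g | ∑ j, ⟪g j, z⟫ ^ 2 ≤ ε ^ 2 * m * ‖z‖ ^ 2}) := by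
        rw [← mul_assoc, ← Real.exp_add]; simp
    _ ≤ _ := by gcongr

end Gaussian

section SmallBalls

variable {W : Type*} [NormedAddCommGroup W] [InnerProductSpace ℝ W] [MeasurableSpace W]
  [BorelSpace W]

open Metric

lemma LogConcMeas.closedBall_mul_le {ν : Measure W} [IsProbabilityMeasure ν] (h : LogConcMeas ν)
    (R : ℝ) (w : W) :
    ν.real (closedBall w R) * ν.real (closedBall 0 R) ≤
      ν.real (closedBall ((1 / 2 : ℝ) • w) R) ^ 2 := by
  have key := h _ _ _ (measurableSet_closedBall (x := w) (ε := R))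
    (measurableSet_closedBall (x := 0) (ε := R))
    (measurableSet_closedBall (x := (1 / 2 : ℝ) • w) (ε := R)) (1 / 2) (by norm_num) (by norm_num)
    (by
      intro x hx y hy
      rw [mem_closedBall, dist_eq_norm] at *
      have : (1 / 2 : ℝ) • x + (1 - 1 / 2 : ℝ) • y - (1 / 2 : ℝ) • w =
          (1 / 2 : ℝ) • (x - w) + (1 / 2 : ℝ) • (y - 0) := by module
      rw [this]
      refine (norm_add_le _ _).trans ?_
      rw [norm_smul, norm_smul, Real.norm_of_nonneg (by norm_num)]
      linarith)
  have e : (1 - 1 / 2 : ℝ) = 1 / 2 := by norm_num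
  rw [e, ← Real.mul_rpow measureReal_nonneg measureReal_nonneg] at key
  have := pow_le_pow_left₀ (by positivity) key 2
  rwa [← Real.sqrt_eq_rpow, Real.sq_sqrt (by positivity)] at this

variable [FiniteDimensional ℝ W]

lemma measurable_measure_closedBall (ν : Measure W) [IsFiniteMeasure ν] (R : ℝ) :
    Measurable fun w => ν (closedBall w R) := by
  have hs : MeasurableSet {q : W × W | dist q.2 q.1 ≤ R} :=
    (isClosed_le (by fun_prop) continuous_const).measurableSet
  exact measurable_measure_prodMk_left hs

lemma lintegral_setLIntegral_closedBall (ν : Measure W) [IsFiniteMeasure ν] {R : ℝ} {S : Set W}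
    (hS : MeasurableSet S) :
    ν S * volume (closedBall (0 : W) R) =
      ∫⁻ w, ν (S ∩ closedBall w R) ∂volume := by
  have hs : MeasurableSet {q : W × W | q.1 ∈ S ∧ dist q.1 q.2 ≤ R} :=
    (measurable_fst hS).inter
      (isClosed_le (continuous_fst.dist continuous_snd) continuous_const).measurableSet
  have h1 := Measure.prod_apply (μ := ν) (ν := volume) hs
  have h2 := Measure.prod_apply_symm (μ := ν) (ν := volume) hs
  have e2 : ∀ w, (fun x => (x, w)) ⁻¹' {q : W × W | q.1 ∈ S ∧ dist q.1 q.2 ≤ R} =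
      S ∩ closedBall w R := fun w => rfl
  have e1 : ∀ x, volume (Prod.mk x ⁻¹' {q : W × W | q.1 ∈ S ∧ dist q.1 q.2 ≤ R}) =
      S.indicator (fun _ => volume (closedBall (0 : W) R)) x := by
    intro x
    by_cases hx : x ∈ S
    · rw [Set.indicator_of_mem hx, ← Measure.addHaar_closedBall_center volume x R]
      congr 1
      ext y
      simp [hx, dist_comm]
    · rw [Set.indicator_of_notMem hx]
      convert measure_empty (μ := (volume : Measure W))
      ext y
      simp [hx]
  rw [h1] at h2
  simp only [e1, e2] at h2
  rw [lintegral_indicator hS, setLIntegral_const] at h2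
  rw [← h2, mul_comm]

/-- Under a log-concave law, few points have small concentration around them. -/
lemma LogConcMeas.measure_closedBall_lt {ν : Measure W} [IsProbabilityMeasure ν]
    (h : LogConcMeas ν) {R c : ℝ} (hR : 0 < R) (hc : 0 ≤ c)
    (h0 : 1 / 2 ≤ ν.real (closedBall 0 R)) :
    ν.real {w | ν.real (closedBall w (2 * R)) < c} ≤ 2 ^ Module.finrank ℝ W * √(2 * c) := by
  set f : W → ℝ≥0∞ := fun w => ν (closedBall w R) with hf
  have hfm : Measurable f := measurable_measure_closedBall ν R
  set S : Set W := {w | ν.real (closedBall w (2 * R)) < c} with hS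
  have hSm : MeasurableSet S :=
    measurableSet_lt (measurable_measure_closedBall ν (2 * R)).ennreal_toReal measurable_const
  set v := volume (closedBall (0 : W) R) with hv
  have hv0 : v ≠ 0 := (measure_closedBall_pos _ _ hR).ne'
  have hvt : v ≠ ⊤ := measure_closedBall_lt_top.ne
  have hle : ∀ w, ν (S ∩ closedBall w R) ≤
      ENNReal.ofReal √(2 * c) * f ((1 / 2 : ℝ) • w) := by
    intro w
    rcases (S ∩ closedBall w R).eq_empty_or_nonempty with he | ⟨y, hyS, hyw⟩
    · simp [he]
    have hwc : ν.real (closedBall w R) < c := by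
      refine lt_of_le_of_lt (measureReal_mono ?_) hyS
      intro x hx
      rw [mem_closedBall] at *
      have := dist_triangle x w y
      rw [dist_comm y w] at hyw
      linarith
    refine (measure_mono Set.inter_subset_right).trans ?_
    have hreal : ν.real (closedBall w R) ≤ √(2 * c) * ν.real (closedBall ((1 / 2 : ℝ) • w) R) := by
      have k := h.closedBall_mul_le R w
      set p := ν.real (closedBall w R)
      set q := ν.real (closedBall ((1 / 2 : ℝ) • w) R)
      have hp : 0 ≤ p := measureReal_nonneg
      have hq : 0 ≤ q := measureReal_nonneg
      refine (sq_le_sq₀ hp (by positivity)).1 ?_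
      rw [mul_pow, Real.sq_sqrt (by positivity)]
      nlinarith
    rw [← ENNReal.ofReal_toReal (measure_ne_top ν (closedBall w R)), hf]
    simp only
    rw [← ENNReal.ofReal_toReal (measure_ne_top ν (closedBall ((1 / 2 : ℝ) • w) R)),
      ← ENNReal.ofReal_mul (by positivity)]
    exact ENNReal.ofReal_le_ofReal hreal
  have hhalf : ∫⁻ w, f ((1 / 2 : ℝ) • w) = ENNReal.ofReal (2 ^ Module.finrank ℝ W) * v := by
    have h1 : ∫⁻ w, f w ∂((volume : Measure W).map ((1 / 2 : ℝ) • ·)) =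
        ∫⁻ w, f ((1 / 2 : ℝ) • w) := lintegral_map hfm (by fun_prop)
    rw [← h1, Measure.map_addHaar_smul volume (by norm_num : (1 / 2 : ℝ) ≠ 0),
      lintegral_smul_measure]
    have h2 := lintegral_setLIntegral_closedBall ν (R := R) MeasurableSet.univ
    simp only [measure_univ, one_mul, Set.univ_inter] at h2
    rw [hf, ← h2, smul_eq_mul]
    congr 2
    rw [← inv_pow, abs_of_nonneg (by positivity)]
    norm_num
  have hmain : ν S * v ≤ ENNReal.ofReal (2 ^ Module.finrank ℝ W * √(2 * c)) * v := by
    rw [lintegral_setLIntegral_closedBall ν hSm]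
    calc _ ≤ ∫⁻ w, ENNReal.ofReal √(2 * c) * f ((1 / 2 : ℝ) • w) := lintegral_mono hle
      _ = _ := by
        rw [lintegral_const_mul _ (f := fun w => f ((1 / 2 : ℝ) • w)) (by fun_prop), hhalf,
          mul_comm (2 ^ _) √(2 * c), ENNReal.ofReal_mul (by positivity), mul_assoc]
  have := (ENNReal.mul_le_mul_iff_left hv0 hvt).1 hmain
  exact ENNReal.toReal_le_of_le_ofReal (by positivity) this

end SmallBalls

section Paouris

variable {V : Type*} [NormedAddCommGroup V] [InnerProductSpace ℝ V]

open Metric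

/-- The matrix with the given rows, as a linear map. -/
def rowsMap {m : ℕ} (g : Fin m → V) : V →L[ℝ] EuclideanSpace ℝ (Fin m) :=
  ((EuclideanSpace.equiv (Fin m) ℝ).symm : (Fin m → ℝ) →L[ℝ] EuclideanSpace ℝ (Fin m)) ∘L
    ContinuousLinearMap.pi fun j => innerSL ℝ (g j)

lemma rowsMap_apply {m : ℕ} (g : Fin m → V) (x : V) (j : Fin m) : rowsMap g x j = ⟪g j, x⟫ := by
  simp [rowsMap]

lemma norm_rowsMap_sq {m : ℕ} (g : Fin m → V) (x : V) :
    ‖rowsMap g x‖ ^ 2 = ∑ j, ⟪g j, x⟫ ^ 2 := by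
  rw [EuclideanSpace.norm_sq_eq]
  simp [rowsMap_apply]

lemma continuous_rowsMap_uncurry {m : ℕ} :
    Continuous fun q : (Fin m → V) × V => rowsMap q.1 q.2 := by
  have h : (fun q : (Fin m → V) × V => rowsMap q.1 q.2) =
      fun q => (EuclideanSpace.equiv (Fin m) ℝ).symm fun j => ⟪q.1 j, q.2⟫ := by
    ext q j
    simp [rowsMap_apply]
  rw [h]
  fun_prop

variable [FiniteDimensional ℝ V] [MeasurableSpace V] [BorelSpace V]

lemma measurable_lintegral_rowsMap_sq (μ : Measure V) [IsFiniteMeasure μ] (m : ℕ) :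
    Measurable fun g : Fin m → V => ∫⁻ x, ENNReal.ofReal (‖rowsMap g x‖ ^ 2) ∂μ := by
  refine Measurable.lintegral_prod_right'
    (f := fun q : (Fin m → V) × V => ENNReal.ofReal (‖rowsMap q.1 q.2‖ ^ 2)) ?_
  exact (continuous_rowsMap_uncurry.norm.pow 2).measurable.ennreal_ofReal

/-- Most Gaussian matrices do not increase the second moment much. -/
lemma half_le_measure_lintegral_rowsMap_sq_le {μ : Measure V} [IsProbabilityMeasure μ]
    {ρ : ℝ} (hρ : 0 < ρ) (hμ : ∫⁻ x, ENNReal.ofReal (‖x‖ ^ 2) ∂μ ≤ ENNReal.ofReal (ρ ^ 2))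
    {m : ℕ} (hm : 1 ≤ m) :
    1 / 2 ≤ (Measure.pi fun _ : Fin m => stdGaussian V).real
      {g | ∫⁻ x, ENNReal.ofReal (‖rowsMap g x‖ ^ 2) ∂μ ≤ ENNReal.ofReal (2 * m * ρ ^ 2)} := by
  set P := (Measure.pi fun _ : Fin m => stdGaussian V)
  have hm0 : (0 : ℝ) < m := by exact_mod_cast hm
  set φ : (Fin m → V) → ℝ≥0∞ := fun g => ∫⁻ x, ENNReal.ofReal (‖rowsMap g x‖ ^ 2) ∂μ with hφ
  have hφm : Measurable φ := measurable_lintegral_rowsMap_sq μ m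
  have hgood : MeasurableSet {g | φ g ≤ ENNReal.ofReal (2 * m * ρ ^ 2)} :=
    measurableSet_le hφm measurable_const
  have h1 : ∫⁻ g, φ g ∂P ≤ ENNReal.ofReal (m * ρ ^ 2) := by
    rw [hφ, lintegral_lintegral_swap]
    · simp_rw [norm_rowsMap_sq]
      simp_rw [P, lintegral_sum_inner_sq_pi, ENNReal.ofReal_mul hm0.le]
      rw [lintegral_const_mul _ (by fun_prop)]
      gcongr
    · exact (continuous_rowsMap_uncurry.norm.pow 2).measurable.ennreal_ofReal.aemeasurable
  have h2 := (mul_meas_ge_le_lintegral hφm (ENNReal.ofReal (2 * m * ρ ^ 2))).trans h1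
  have h3 := ENNReal.toReal_mono (by finiteness) h2
  rw [ENNReal.toReal_mul, ENNReal.toReal_ofReal (by positivity),
    ENNReal.toReal_ofReal (by positivity)] at h3
  have h4 : P.real {g | φ g ≤ ENNReal.ofReal (2 * m * ρ ^ 2)}ᶜ ≤
      P.real {g | ENNReal.ofReal (2 * m * ρ ^ 2) ≤ φ g} := by
    refine measureReal_mono fun g hg => ?_
    exact (not_le.1 (show ¬ φ g ≤ ENNReal.ofReal (2 * m * ρ ^ 2) from hg)).le
  rw [probReal_compl_eq_one_sub hgood] at h4
  have h5 : m * ρ ^ 2 * (2 * P.real {g | ENNReal.ofReal (2 * m * ρ ^ 2) ≤ φ g}) ≤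
      m * ρ ^ 2 * 1 := by
    simp only [Measure.real]; linarith
  have := le_of_mul_le_mul_left h5 (by positivity)
  linarith

/-- A universal radius constant. -/
def radK : ℝ := 131072 * exp 1 ^ 3

lemma measurableSet_dist_rowsMap (m : ℕ) (s : ℝ) :
    MeasurableSet {q : ((Fin m → V) × V) × V |
      dist (rowsMap q.1.1 q.2) (rowsMap q.1.1 q.1.2) ≤ s} := by
  refine (isClosed_le (Continuous.dist ?_ ?_) continuous_const).measurableSet
  · exact continuous_rowsMap_uncurry.comp (by fun_prop : Continuous
      fun q : ((Fin m → V) × V) × V => (q.1.1, q.2))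
  · exact continuous_rowsMap_uncurry.comp (by fun_prop : Continuous
      fun q : ((Fin m → V) × V) × V => (q.1.1, q.1.2))

/-- If there is little mass around `x`, then the same holds for most Gaussian images. -/
lemma measure_rowsMap_concentrated_le {μ : Measure V} [IsProbabilityMeasure μ] {ρ : ℝ} (hρ : 0 < ρ)
    {m : ℕ} (hm : 1 ≤ m) {x : V}
    (hx : μ.real (closedBall x (radK * ρ)) < ((2 * exp 1) ^ (2 * m))⁻¹ / 8192) :
    (Measure.pi fun _ : Fin m => stdGaussian V)
      {g | ((2 * exp 1) ^ (2 * m))⁻¹ / 512 ≤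
        μ.real {y | dist (rowsMap g y) (rowsMap g x) ≤ 4 * √m * ρ}} ≤ ENNReal.ofReal (1 / 8) := by
  set P := (Measure.pi fun _ : Fin m => stdGaussian V)
  have hm0 : (0 : ℝ) < m := by exact_mod_cast hm
  have he : 0 < exp 1 := Real.exp_pos 1
  set c₀ : ℝ := ((2 * exp 1) ^ (2 * m))⁻¹ with hc₀
  have hc₀p : 0 < c₀ := by positivity
  have hK : 0 < radK := by unfold radK; positivity
  set s : ℝ := 4 * √m * ρ with hs
  have hD : MeasurableSet {q : (Fin m → V) × V | dist (rowsMap q.1 q.2) (rowsMap q.1 x) ≤ s} :=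
    ((by fun_prop : Measurable fun q : (Fin m → V) × V => ((q.1, x), q.2)))
      (measurableSet_dist_rowsMap m s)
  have hsmall : (exp 1 * (4 / radK)) ^ m ≤ c₀ / 8192 := by
    have e1 : exp 1 * (4 / radK) = ((2 * exp 1) ^ 2)⁻¹ * (1 / 8192) := by
      unfold radK; field_simp; norm_num
    rw [e1, mul_pow, inv_pow, ← pow_mul, ← hc₀, div_eq_mul_one_div c₀]
    exact mul_le_mul_of_nonneg_left
      (pow_le_of_le_one (by norm_num) (by norm_num) (by lia)) hc₀p.le
  have hbound : ∀ y, P {g | dist (rowsMap g y) (rowsMap g x) ≤ s} ≤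
      (closedBall x (radK * ρ)).indicator 1 y + ENNReal.ofReal (c₀ / 8192) := by
    intro y
    by_cases hy : y ∈ closedBall x (radK * ρ)
    · rw [Set.indicator_of_mem hy]
      exact prob_le_one.trans (by simp)
    rw [Set.indicator_of_notMem hy, zero_add]
    rw [mem_closedBall, not_le, dist_eq_norm] at hy
    have hz : y - x ≠ 0 := by
      intro h0; rw [h0, norm_zero] at hy
      exact absurd hy (not_lt.2 (by positivity))
    have hsb := small_ball_pi m hz (ε := 4 / radK) (by positivity)
    rw [← ENNReal.ofReal_toReal (measure_ne_top P {g | dist (rowsMap g y) (rowsMap g x) ≤ s})]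
    refine ENNReal.ofReal_le_ofReal (le_trans ?_ (hsb.trans hsmall))
    refine measureReal_mono fun g hg => ?_
    change ∑ j, ⟪g j, y - x⟫ ^ 2 ≤ (4 / radK) ^ 2 * m * ‖y - x‖ ^ 2
    have hg : dist (rowsMap g y) (rowsMap g x) ≤ s := hg
    rw [dist_eq_norm, ← map_sub] at hg
    rw [← norm_rowsMap_sq]
    calc ‖rowsMap g (y - x)‖ ^ 2 ≤ s ^ 2 := by gcongr
      _ = (4 / radK) ^ 2 * m * (radK * ρ) ^ 2 := by
          rw [hs, mul_pow, mul_pow, Real.sq_sqrt hm0.le]; field_simp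
      _ ≤ _ := by gcongr
  have h1 := Measure.prod_apply (μ := P) (ν := μ) hD
  have h2 := Measure.prod_apply_symm (μ := P) (ν := μ) hD
  rw [h1] at h2
  have h3 : ∫⁻ g, μ {y | dist (rowsMap g y) (rowsMap g x) ≤ s} ∂P ≤ ENNReal.ofReal (c₀ / 4096) := by
    refine h2.le.trans ((lintegral_mono hbound).trans ?_)
    rw [lintegral_add_left (measurable_one.indicator measurableSet_closedBall),
      lintegral_indicator_one measurableSet_closedBall, lintegral_const, measure_univ, mul_one]
    have : μ (closedBall x (radK * ρ)) ≤ ENNReal.ofReal (c₀ / 8192) := by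
      rw [← ENNReal.ofReal_toReal (measure_ne_top μ (closedBall x (radK * ρ)))]
      exact ENNReal.ofReal_le_ofReal hx.le
    calc _ ≤ ENNReal.ofReal (c₀ / 8192) + ENNReal.ofReal (c₀ / 8192) := by gcongr
      _ = _ := by
        rw [← ENNReal.ofReal_add (by positivity) (by positivity)]; congr 1; ring
  have h4 := (mul_meas_ge_le_lintegral (measurable_measure_prodMk_left hD)
    (ENNReal.ofReal (c₀ / 512))).trans h3
  have h5 : ENNReal.ofReal (c₀ / 512) * P {g | c₀ / 512 ≤
      μ.real {y | dist (rowsMap g y) (rowsMap g x) ≤ s}} ≤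
      ENNReal.ofReal (c₀ / 512) * ENNReal.ofReal (1 / 8) := by
    rw [← ENNReal.ofReal_mul (by positivity)]
    refine le_trans ?_ (h4.trans_eq (by congr 1; ring))
    gcongr
    intro hg
    exact (ENNReal.ofReal_le_iff_le_toReal (measure_ne_top μ _)).2 hg
  exact (ENNReal.mul_le_mul_iff_right (by positivity) ENNReal.ofReal_ne_top).1 h5

/-- Under a log-concave law with bounded second moment, few points have little mass around. -/
lemma LogConcMeas.measure_isolated_le {μ : Measure V} [IsProbabilityMeasure μ] (h : LogConcMeas μ)
    {ρ : ℝ} (hρ : 0 < ρ) (hμ : ∫⁻ x, ENNReal.ofReal (‖x‖ ^ 2) ∂μ ≤ ENNReal.ofReal (ρ ^ 2))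
    {m : ℕ} (hm : 1 ≤ m) :
    μ.real {x | μ.real (closedBall x (radK * ρ)) < ((2 * exp 1) ^ (2 * m))⁻¹ / 8192} ≤
      exp (-m) / 6 := by
  set P := (Measure.pi fun _ : Fin m => stdGaussian V)
  have hm0 : (0 : ℝ) < m := by exact_mod_cast hm
  have he : 0 < exp 1 := Real.exp_pos 1
  set c₀ : ℝ := ((2 * exp 1) ^ (2 * m))⁻¹ with hc₀
  have hc₀p : 0 < c₀ := by positivity
  set s : ℝ := 4 * √m * ρ with hs
  set good : Set (Fin m → V) :=
    {g | ∫⁻ x, ENNReal.ofReal (‖rowsMap g x‖ ^ 2) ∂μ ≤ ENNReal.ofReal (2 * m * ρ ^ 2)} with hgood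
  have hgm : MeasurableSet good :=
    measurableSet_le (measurable_lintegral_rowsMap_sq μ m) measurable_const
  set T : Set V := {x | μ.real (closedBall x (radK * ρ)) < c₀ / 8192}
  have hTm : MeasurableSet T :=
    measurableSet_lt (measurable_measure_closedBall μ (radK * ρ)).ennreal_toReal measurable_const
  set F : (Fin m → V) × V → ℝ := fun q =>
    μ.real {y | dist (rowsMap q.1 y) (rowsMap q.1 q.2) ≤ s} with hF
  have hFm : Measurable F :=
    (measurable_measure_prodMk_left (ν := μ) (measurableSet_dist_rowsMap m s)).ennreal_toReal
  set S₁ : Set ((Fin m → V) × V) := {q | q.1 ∈ good ∧ F q < c₀ / 512} with hS₁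
  set S₂ : Set ((Fin m → V) × V) := {q | q.2 ∈ T ∧ c₀ / 512 ≤ F q} with hS₂
  have hS₁m : MeasurableSet S₁ :=
    (measurable_fst hgm).inter (measurableSet_lt hFm measurable_const)
  have hS₂m : MeasurableSet S₂ :=
    (measurable_snd hTm).inter (measurableSet_le measurable_const hFm)
  have hb₁ : (P.prod μ) S₁ ≤ ENNReal.ofReal (exp (-m) / 16) := by
    rw [Measure.prod_apply hS₁m]
    have : ∀ g, μ (Prod.mk g ⁻¹' S₁) ≤ ENNReal.ofReal (exp (-m) / 16) := by
      intro g
      by_cases hg : g ∈ good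
      swap
      · have : Prod.mk g ⁻¹' S₁ = ∅ := by ext x; simp [hS₁, hg]
        simp [this]
      have hLm : Measurable (rowsMap g) := (rowsMap g).continuous.measurable
      have : IsProbabilityMeasure (μ.map (rowsMap g)) :=
        Measure.isProbabilityMeasure_map hLm.aemeasurable
      have hR : 0 < 2 * √m * ρ := by positivity
      have hhalf : 1 / 2 ≤ (μ.map (rowsMap g)).real (closedBall 0 (2 * √m * ρ)) := by
        rw [map_measureReal_apply hLm measurableSet_closedBall]
        have hg' := (mul_meas_ge_le_lintegral (μ := μ)
          (f := fun x => ENNReal.ofReal (‖rowsMap g x‖ ^ 2)) (by fun_prop)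
          (ENNReal.ofReal (4 * m * ρ ^ 2))).trans hg
        have h3 := ENNReal.toReal_mono (by finiteness) hg'
        rw [ENNReal.toReal_mul, ENNReal.toReal_ofReal (by positivity),
          ENNReal.toReal_ofReal (by positivity)] at h3
        have h4 : 1 - μ.real (rowsMap g ⁻¹' closedBall 0 (2 * √m * ρ)) ≤
            μ.real {x | ENNReal.ofReal (4 * m * ρ ^ 2) ≤ ENNReal.ofReal (‖rowsMap g x‖ ^ 2)} := by
          rw [← probReal_compl_eq_one_sub (hLm measurableSet_closedBall)]
          refine measureReal_mono fun x hx => ?_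
          have hx : 2 * √m * ρ < ‖rowsMap g x‖ := by simpa using hx
          refine ENNReal.ofReal_le_ofReal ?_
          have : 4 * m * ρ ^ 2 = (2 * √m * ρ) ^ 2 := by
            rw [mul_pow, mul_pow, Real.sq_sqrt hm0.le]; ring
          rw [this]
          gcongr
        have h5 : 2 * m * ρ ^ 2 * (2 * μ.real
            {x | ENNReal.ofReal (4 * m * ρ ^ 2) ≤ ENNReal.ofReal (‖rowsMap g x‖ ^ 2)}) ≤
            2 * m * ρ ^ 2 * 1 := by
          simp only [Measure.real]; linarith
        have := le_of_mul_le_mul_left h5 (by positivity)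
        linarith
      have key := (h.map (rowsMap g)).measure_closedBall_lt hR (c := c₀ / 512) (by positivity) hhalf
      have hmeas : ∀ x, (μ.map (rowsMap g)).real (closedBall (rowsMap g x) (2 * (2 * √m * ρ))) =
          F (g, x) := by
        intro x
        rw [map_measureReal_apply hLm measurableSet_closedBall, hF, hs]
        congr 1
        ext y
        simp only [Set.mem_preimage, mem_closedBall]
        ring_nf
        rfl
      have hT' : MeasurableSet {w | (μ.map (rowsMap g)).real (closedBall w (2 * (2 * √m * ρ))) <
          c₀ / 512} :=
        measurableSet_lt (measurable_measure_closedBall _ _).ennreal_toReal measurable_const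
      rw [map_measureReal_apply hLm hT', finrank_euclideanSpace, Fintype.card_fin] at key
      have hval : (2 : ℝ) ^ m * √(2 * (c₀ / 512)) = exp (-m) / 16 := by
        have e1 : 2 * (c₀ / 512) = (((2 * exp 1) ^ m)⁻¹ / 16) ^ 2 := by
          rw [hc₀, pow_mul']; field_simp; norm_num
        rw [e1, Real.sqrt_sq (by positivity), mul_pow, ← Real.exp_nat_mul, mul_one, Real.exp_neg]
        field_simp
      rw [hval] at key
      rw [← ENNReal.ofReal_toReal (measure_ne_top μ (Prod.mk g ⁻¹' S₁))]
      refine ENNReal.ofReal_le_ofReal (le_trans (measureReal_mono ?_) key)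
      intro x hx
      have hx : F (g, x) < c₀ / 512 := hx.2
      rw [← hmeas] at hx
      exact hx
    calc _ ≤ ∫⁻ _, ENNReal.ofReal (exp (-m) / 16) ∂P := lintegral_mono this
      _ = _ := by simp
  have hb₂ : (P.prod μ) S₂ ≤ ENNReal.ofReal (1 / 8) * μ T := by
    rw [Measure.prod_apply_symm hS₂m, ← setLIntegral_const, ← lintegral_indicator hTm]
    refine lintegral_mono fun x => ?_
    by_cases hx : x ∈ T
    · rw [Set.indicator_of_mem hx]
      refine le_trans (measure_mono ?_) (measure_rowsMap_concentrated_le hρ hm hx)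
      intro g hg
      exact hg.2
    · have : (fun g => (g, x)) ⁻¹' S₂ = ∅ := by ext g; simp [hS₂, hx]
      rw [this, Set.indicator_of_notMem hx, measure_empty]
  have hsub : good ×ˢ T ⊆ S₁ ∪ S₂ := by
    rintro ⟨g, x⟩ ⟨hg, hx⟩
    rcases lt_or_ge (F (g, x)) (c₀ / 512) with hlt | hge
    · exact Or.inl ⟨hg, hlt⟩
    · exact Or.inr ⟨hx, hge⟩
  have hfin : P good * μ T ≤ ENNReal.ofReal (exp (-m) / 16) + ENNReal.ofReal (1 / 8) * μ T := by
    rw [← Measure.prod_prod]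
    exact (measure_mono hsub).trans ((measure_union_le _ _).trans (add_le_add hb₁ hb₂))
  have hfr := ENNReal.toReal_mono (by finiteness) hfin
  rw [ENNReal.toReal_add (by finiteness) (by finiteness), ENNReal.toReal_mul, ENNReal.toReal_mul,
    ENNReal.toReal_ofReal (by positivity), ENNReal.toReal_ofReal (by positivity)] at hfr
  have hg2 : 1 / 2 ≤ P.real good := half_le_measure_lintegral_rowsMap_sq_le hρ hμ hm
  change P.real good * μ.real T ≤ exp (-m) / 16 + 1 / 8 * μ.real T at hfr
  have hT0 : 0 ≤ μ.real T := measureReal_nonneg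
  nlinarith

end Paouris

section Projections

open Metric

/-- Paouris-type deviation inequality for the Euclidean norm. -/
lemma LogConcMeas.norm_tail {V : Type*} [NormedAddCommGroup V] [InnerProductSpace ℝ V]
    [FiniteDimensional ℝ V] [MeasurableSpace V] [BorelSpace V]
    {μ : Measure V} [IsProbabilityMeasure μ] (h : LogConcMeas μ) {ρ τ : ℝ}
    (hρ : 0 < ρ) (hτ : 0 ≤ τ) (hμ : ∫⁻ x, ENNReal.ofReal (‖x‖ ^ 2) ∂μ ≤ ENNReal.ofReal (ρ ^ 2))
    {m : ℕ} (hm : 1 ≤ m)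
    (hu : ∀ u : V, ‖u‖ ≤ 1 → μ.real {x | τ ≤ |⟪u, x⟫|} < ((2 * exp 1) ^ (2 * m))⁻¹ / 8192) :
    μ.real {x | radK * ρ + τ < ‖x‖} ≤ exp (-m) / 6 := by
  refine (measureReal_mono ?_).trans (h.measure_isolated_le hρ hμ hm)
  intro x hx
  have hx : radK * ρ + τ < ‖x‖ := hx
  have hK : 0 < radK * ρ := by unfold radK; positivity
  have hx0 : 0 < ‖x‖ := by linarith
  have hun : ‖‖x‖⁻¹ • x‖ = 1 := by
    rw [norm_smul, norm_inv, norm_norm, inv_mul_cancel₀ hx0.ne']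
  refine lt_of_le_of_lt (measureReal_mono ?_) (hu (‖x‖⁻¹ • x) hun.le)
  intro y hy
  rw [mem_closedBall, dist_eq_norm] at hy
  change τ ≤ |⟪‖x‖⁻¹ • x, y⟫|
  have h1 : ⟪‖x‖⁻¹ • x, y⟫ = ‖x‖ + ⟪‖x‖⁻¹ • x, y - x⟫ := by
    rw [inner_sub_right, real_inner_smul_left _ x, real_inner_self_eq_norm_sq]
    field_simp
    ring
  have h2 : |⟪‖x‖⁻¹ • x, y - x⟫| ≤ ‖y - x‖ := by
    have := abs_real_inner_le_norm (‖x‖⁻¹ • x) (y - x)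
    rwa [hun, one_mul] at this
  have h3 := neg_abs_le ⟪‖x‖⁻¹ • x, y - x⟫
  refine le_trans ?_ (le_abs_self _)
  linarith

variable {n : ℕ}

/-- Coordinate projection. -/
def coordProj (I : Finset (Fin n)) : EuclideanSpace ℝ (Fin n) →L[ℝ] EuclideanSpace ℝ (Fin n) :=
  ((EuclideanSpace.equiv (Fin n) ℝ).symm : (Fin n → ℝ) →L[ℝ] EuclideanSpace ℝ (Fin n)) ∘L
    ContinuousLinearMap.pi fun j => (if j ∈ I then (1 : ℝ) else 0) • EuclideanSpace.proj j

lemma coordProj_apply (I : Finset (Fin n)) (x : EuclideanSpace ℝ (Fin n)) (j : Fin n) :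
    coordProj I x j = if j ∈ I then x j else 0 := by
  by_cases h : j ∈ I <;> simp [coordProj, h]

lemma norm_coordProj_sq (I : Finset (Fin n)) (x : EuclideanSpace ℝ (Fin n)) :
    ‖coordProj I x‖ ^ 2 = ∑ i ∈ I, x i ^ 2 := by
  rw [EuclideanSpace.norm_sq_eq]
  simp [coordProj_apply]

lemma norm_coordProj_le (I : Finset (Fin n)) (x : EuclideanSpace ℝ (Fin n)) :
    ‖coordProj I x‖ ≤ ‖x‖ := by
  refine (sq_le_sq₀ (norm_nonneg _) (norm_nonneg _)).1 ?_
  rw [norm_coordProj_sq, EuclideanSpace.norm_sq_eq]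
  simp only [Real.norm_eq_abs, sq_abs]
  exact Finset.sum_le_univ_sum_of_nonneg fun _ => sq_nonneg _

lemma inner_coordProj (I : Finset (Fin n)) (u x : EuclideanSpace ℝ (Fin n)) :
    ⟪u, coordProj I x⟫ = ⟪coordProj I u, x⟫ := by
  simp only [PiLp.inner_apply, coordProj_apply]
  refine Finset.sum_congr rfl fun i _ => ?_
  split_ifs <;> simp

lemma lintegral_norm_coordProj_sq (μ : Measure (EuclideanSpace ℝ (Fin n)))
    (I : Finset (Fin n)) :
    ∫⁻ x, ENNReal.ofReal (‖coordProj I x‖ ^ 2) ∂μ =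
      ∑ i ∈ I, ∫⁻ x, ENNReal.ofReal (x i ^ 2) ∂μ := by
  rw [← lintegral_finsetSum _ (fun i _ => by fun_prop)]
  refine lintegral_congr fun x => ?_
  rw [norm_coordProj_sq, ENNReal.ofReal_sum_of_nonneg fun _ _ => sq_nonneg _]

/-- The integral `r ∫ t^(r-1) √ν(|xᵢ| > t) dt`. -/
def sqrtTail (ν : Measure (EuclideanSpace ℝ (Fin n))) (r : ℝ) (i : Fin n) : ℝ≥0∞ :=
  ENNReal.ofReal r * ∫⁻ t in Set.Ioi (0 : ℝ),
    ENNReal.ofReal √(ν.real {x | t < |x i|}) * ENNReal.ofReal (t ^ (r - 1))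

lemma LogConcMeas.coord_tail {ν : Measure (EuclideanSpace ℝ (Fin n))} [IsProbabilityMeasure ν]
    (h : LogConcMeas ν) {b : ℝ} (hb : 0 < b) {i : Fin n}
    (hν : ∫⁻ x, ENNReal.ofReal (x i ^ 2) ∂ν ≤ ENNReal.ofReal (b ^ 2)) (t : ℝ) :
    ν.real {x | t < |x i|} ≤ 2 * exp (-t / (4 * b)) := by
  have := h.tail_of_sq (EuclideanSpace.proj i : EuclideanSpace ℝ (Fin n) →L[ℝ] ℝ) hb
    (by simpa using hν) (t / b)
  rw [div_mul_cancel₀ _ hb.ne'] at this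
  have e : -t / (4 * b) = -(t / b) / 4 := by field_simp
  rw [e]
  exact this

lemma sqrt_two_mul_exp_le (x : ℝ) : √(2 * exp x) ≤ 2 * exp (x / 2) := by
  apply Real.sqrt_le_iff.2 ⟨by positivity, ?_⟩
  rw [mul_pow, ← Real.exp_nat_mul]
  have : ((2 : ℕ) : ℝ) * (x / 2) = x := by push_cast; ring
  rw [this]
  nlinarith [Real.exp_pos x]

lemma LogConcMeas.sqrtTail_le_of_small {ν : Measure (EuclideanSpace ℝ (Fin n))}
    [IsProbabilityMeasure ν] (h : LogConcMeas ν) {b r : ℝ} (hb : 0 < b) (hr : 1 ≤ r) {i : Fin n}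
    (hν : ∫⁻ x, ENNReal.ofReal (x i ^ 2) ∂ν ≤ ENNReal.ofReal (b ^ 2)) :
    sqrtTail ν r i ≤ ENNReal.ofReal (2 * (16 * b * r) ^ r) := by
  have := lintegral_rpow_mul_le_of_exp_decay (G := fun t => √(ν.real {x | t < |x i|})) (D := 2)
    (q := r) (β := 8 * b) (by norm_num) hr (by positivity) (fun t _ => by
      refine (Real.sqrt_le_sqrt (h.coord_tail hb hν t)).trans
        ((sqrt_two_mul_exp_le _).trans_eq ?_)
      congr 2; field_simp; ring)
  refine this.trans_eq ?_
  ring_nf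

lemma LogConcMeas.sqrtTail_le_of_large {ν : Measure (EuclideanSpace ℝ (Fin n))}
    [IsProbabilityMeasure ν] (h : LogConcMeas ν) {b r p S : ℝ} (hb : 0 < b) (hr : 2 ≤ r)
    (hp : 4 * r ≤ p) (hS : 0 < S) {i : Fin n}
    (hν : ∫⁻ x, ENNReal.ofReal (x i ^ 2) ∂ν ≤ ENNReal.ofReal (b ^ 2))
    (htail : ∀ t, 0 < t → ν.real {x | t < |x i|} ≤ (S / t) ^ p) :
    sqrtTail ν r i ≤ ENNReal.ofReal (4096 * r * S ^ (r - 2) * b ^ 2) := by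
  set G : ℝ → ℝ := fun t => √√(ν.real {x | t < |x i|}) with hG
  have h1 := lintegral_rpow_mul_le_of_exp_decay (G := G) (D := 2)
    (q := 2) (β := 16 * b) (by norm_num) (by norm_num) (by positivity) (fun t _ => by
      have e1 := Real.sqrt_le_sqrt ((Real.sqrt_le_sqrt (h.coord_tail hb hν t)).trans
        (sqrt_two_mul_exp_le _))
      refine e1.trans ((sqrt_two_mul_exp_le _).trans_eq ?_)
      congr 2; field_simp; ring)
  have hpt : ∀ t, 0 < t → √(ν.real {x | t < |x i|}) * t ^ (r - 1) ≤
      S ^ (r - 2) * (G t * t ^ ((2 : ℝ) - 1)) := by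
    intro t ht
    have hle : G t * t ^ (r - 2) ≤ S ^ (r - 2) := by
      have hv0 : 0 ≤ ν.real {x | t < |x i|} := measureReal_nonneg
      have hv1 : ν.real {x | t < |x i|} ≤ 1 := measureReal_le_one
      rcases le_or_gt t S with hts | hts
      · have : G t ≤ 1 := by
          rw [hG]
          exact Real.sqrt_le_one.2 (Real.sqrt_le_one.2 hv1)
        calc G t * t ^ (r - 2) ≤ 1 * S ^ (r - 2) := by
              gcongr
          _ = _ := one_mul _
      · have hst : S / t ≤ 1 := by rw [div_le_one ht]; exact hts.le
        have hst0 : 0 < S / t := by positivity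
        have h2 : G t ≤ (S / t) ^ (r - 2) := by
          rw [hG]
          simp only
          rw [Real.sqrt_le_iff]
          refine ⟨by positivity, ?_⟩
          rw [Real.sqrt_le_iff]
          refine ⟨by positivity, (htail t ht).trans ?_⟩
          rw [← pow_mul, ← Real.rpow_mul_natCast hst0.le]
          exact Real.rpow_le_rpow_of_exponent_ge hst0 hst (by push_cast; linarith)
        calc G t * t ^ (r - 2) ≤ (S / t) ^ (r - 2) * t ^ (r - 2) := by gcongr
          _ = S ^ (r - 2) := by
            rw [← Real.mul_rpow hst0.le ht.le, div_mul_cancel₀ _ ht.ne']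
    have e1 : √(ν.real {x | t < |x i|}) = G t * G t := by
      rw [hG]; simp only; rw [Real.mul_self_sqrt (Real.sqrt_nonneg _)]
    have e2 : t ^ (r - 1) = t ^ (r - 2) * t := by
      rw [← Real.rpow_add_one ht.ne']; congr 1; ring
    have e3 : t ^ ((2 : ℝ) - 1) = t := by norm_num
    have hG0 : 0 ≤ G t := Real.sqrt_nonneg _
    rw [e1, e2, e3]
    calc _ = (G t * t ^ (r - 2)) * (G t * t) := by ring
      _ ≤ _ := by gcongr
  have h2 : ∫⁻ t in Set.Ioi (0 : ℝ),
      ENNReal.ofReal √(ν.real {x | t < |x i|}) * ENNReal.ofReal (t ^ (r - 1)) ≤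
      ENNReal.ofReal (S ^ (r - 2)) *
        ∫⁻ t in Set.Ioi (0 : ℝ), ENNReal.ofReal (G t) * ENNReal.ofReal (t ^ ((2 : ℝ) - 1)) := by
    rw [← lintegral_const_mul' _ _ ENNReal.ofReal_ne_top]
    refine setLIntegral_mono' measurableSet_Ioi fun t (ht : 0 < t) => ?_
    rw [← ENNReal.ofReal_mul (by positivity), ← ENNReal.ofReal_mul (by positivity),
      ← ENNReal.ofReal_mul (by positivity)]
    exact ENNReal.ofReal_le_ofReal (hpt t ht)
  have e4 : ENNReal.ofReal r = ENNReal.ofReal (r / 2) * ENNReal.ofReal 2 := by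
    rw [← ENNReal.ofReal_mul (by positivity)]; congr 1; ring
  unfold sqrtTail
  calc _ ≤ ENNReal.ofReal r * (ENNReal.ofReal (S ^ (r - 2)) *
        ∫⁻ t in Set.Ioi (0 : ℝ), ENNReal.ofReal (G t) * ENNReal.ofReal (t ^ ((2 : ℝ) - 1))) := by
        gcongr
    _ = ENNReal.ofReal (r / 2) * ENNReal.ofReal (S ^ (r - 2)) * (ENNReal.ofReal 2 *
        ∫⁻ t in Set.Ioi (0 : ℝ), ENNReal.ofReal (G t) * ENNReal.ofReal (t ^ ((2 : ℝ) - 1))) := by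
        rw [e4]; ring
    _ ≤ ENNReal.ofReal (r / 2) * ENNReal.ofReal (S ^ (r - 2)) *
        ENNReal.ofReal (2 * (2 * (16 * b) * 2) ^ (2 : ℝ)) := by gcongr
    _ = _ := by
        rw [← ENNReal.ofReal_mul (by positivity), ← ENNReal.ofReal_mul (by positivity)]
        congr 1
        rw [Real.rpow_two]; ring

end Projections

section Conditioning

variable {n : ℕ}

lemma measureReal_le_of_moment {V : Type*} [NormedAddCommGroup V] [InnerProductSpace ℝ V]
    [MeasurableSpace V] [BorelSpace V] {μ : Measure V} [IsFiniteMeasure μ] {p S τ : ℝ}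
    (hp : 0 < p) (hS : 0 < S) (hτ : 0 < τ) {u : V}
    (hu : ∫⁻ x, ENNReal.ofReal (|⟪u, x⟫| ^ p) ∂μ ≤ ENNReal.ofReal (S ^ p)) :
    μ.real {x | τ ≤ |⟪u, x⟫|} ≤ (S / τ) ^ p := by
  have hc : Continuous fun x : V => |⟪u, x⟫| := by fun_prop
  have h1 := (mul_meas_ge_le_lintegral (μ := μ)
    (f := fun x => ENNReal.ofReal (|⟪u, x⟫| ^ p))
    (hc.measurable.pow_const p).ennreal_ofReal (ENNReal.ofReal (τ ^ p))).trans hu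
  have h2 := ENNReal.toReal_mono (by finiteness) h1
  rw [ENNReal.toReal_mul, ENNReal.toReal_ofReal (by positivity),
    ENNReal.toReal_ofReal (by positivity)] at h2
  rw [Real.div_rpow hS.le hτ.le, le_div_iff₀ (by positivity), mul_comm]
  refine le_trans ?_ h2
  gcongr
  refine measureReal_mono fun x (hx : τ ≤ |⟪u, x⟫|) => ?_
  exact ENNReal.ofReal_le_ofReal (by gcongr)

lemma inv_rpow_lt_inv_pow {p : ℝ} (hp : 8 ≤ p) :
    (1 / 186624 : ℝ) ^ p < ((2 * exp 1) ^ (2 * ⌈2 * p⌉₊))⁻¹ / 8192 := by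
  have he : 2 * exp 1 ≤ 6 := by linarith [Real.exp_one_lt_three]
  have hm : (⌈2 * p⌉₊ : ℝ) ≤ 3 * p := by
    have := Nat.ceil_lt_add_one (by linarith : 0 ≤ 2 * p)
    linarith
  have h1 : (2 * exp 1) ^ (2 * ⌈2 * p⌉₊) ≤ (46656 : ℝ) ^ p := by
    calc (2 * exp 1) ^ (2 * ⌈2 * p⌉₊) ≤ (6 : ℝ) ^ (2 * ⌈2 * p⌉₊) := by gcongr
      _ = (6 : ℝ) ^ (((2 * ⌈2 * p⌉₊ : ℕ) : ℝ)) := by rw [Real.rpow_natCast]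
      _ ≤ (6 : ℝ) ^ (((6 : ℕ) : ℝ) * p) := by
          apply Real.rpow_le_rpow_of_exponent_le (by norm_num)
          push_cast
          linarith
      _ = (46656 : ℝ) ^ p := by
          rw [Real.rpow_mul (by norm_num), Real.rpow_natCast]; norm_num
  have h2 : (8192 : ℝ) < 4 ^ p := by
    calc (8192 : ℝ) < 4 ^ ((8 : ℕ) : ℝ) := by rw [Real.rpow_natCast]; norm_num
      _ ≤ 4 ^ p := Real.rpow_le_rpow_of_exponent_le (by norm_num) (by push_cast; exact hp)
  have h3 : (1 / 186624 : ℝ) ^ p = ((46656 : ℝ) ^ p * 4 ^ p)⁻¹ := by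
    rw [← Real.mul_rpow (by norm_num) (by norm_num), one_div, Real.inv_rpow (by norm_num)]
    norm_num
  rw [h3, div_eq_mul_inv, ← mul_inv]
  refine inv_strictAnti₀ (by positivity) ?_
  exact mul_lt_mul' h1 h2 (by norm_num) (by positivity)

lemma LogConcMeas.coordProj_tail {μ : Measure (EuclideanSpace ℝ (Fin n))} [IsProbabilityMeasure μ]
    (h : LogConcMeas μ) {p S : ℝ} (hp : 8 ≤ p) (hS : 0 < S)
    (hiso : ∀ i, ∫⁻ x, ENNReal.ofReal (x i ^ 2) ∂μ ≤ 1)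
    (hσ : ∀ u : EuclideanSpace ℝ (Fin n), ‖u‖ ≤ 1 →
      ∫⁻ x, ENNReal.ofReal (|⟪u, x⟫| ^ p) ∂μ ≤ ENNReal.ofReal (S ^ p))
    {I : Finset (Fin n)} (hI : I.Nonempty) :
    μ.real {x | radK * √(I.card) + 186624 * S < ‖coordProj I x‖} ≤ exp (-(2 * p)) / 6 := by
  have hcm : Measurable (coordProj I) := (coordProj I).continuous.measurable
  have : IsProbabilityMeasure (μ.map (coordProj I)) :=
    Measure.isProbabilityMeasure_map hcm.aemeasurable
  have hcard : (0 : ℝ) < I.card := by exact_mod_cast hI.card_pos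
  have key := (h.map (coordProj I)).norm_tail (ρ := √(I.card)) (τ := 186624 * S)
    (m := ⌈2 * p⌉₊) (by positivity) (by positivity) (by
      rw [lintegral_map (by fun_prop) hcm, lintegral_norm_coordProj_sq, Real.sq_sqrt hcard.le]
      refine (Finset.sum_le_sum fun i _ => hiso i).trans ?_
      simp) (Nat.one_le_ceil_iff.2 (by linarith)) (by
      intro u hu
      have hc : Continuous fun x : EuclideanSpace ℝ (Fin n) => |⟪u, x⟫| := by fun_prop
      rw [map_measureReal_apply hcm (isClosed_le continuous_const hc).measurableSet]
      refine lt_of_le_of_lt ?_ (inv_rpow_lt_inv_pow hp)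
      have := measureReal_le_of_moment (τ := 186624 * S) (by linarith) hS (by positivity)
        (hσ (coordProj I u) ((norm_coordProj_le I u).trans hu))
      have e : S / (186624 * S) = 1 / 186624 := by field_simp
      rw [e] at this
      refine le_trans (le_of_eq ?_) this
      congr 1
      ext x
      change _ ≤ |⟪u, coordProj I x⟫| ↔ _ ≤ |⟪coordProj I u, x⟫|
      rw [inner_coordProj])
  rw [map_measureReal_apply hcm (isOpen_lt continuous_const continuous_norm).measurableSet] at key
  refine key.trans ?_
  have := Nat.le_ceil (2 * p)
  gcongr

lemma cond_real_le {α : Type*} [MeasurableSpace α] {μ : Measure α} [IsFiniteMeasure μ] {A : Set α}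
    (hA : MeasurableSet A) {q : ℝ} (hq : exp (-q) ≤ μ.real A) (B : Set α) :
    μ[|A].real B ≤ exp q * μ.real B := by
  have h : μ[|A].real B = (μ.real A)⁻¹ * μ.real (A ∩ B) := by
    simp [Measure.real, cond_apply hA, ENNReal.toReal_mul]
  rw [h]
  have h2 : (μ.real A)⁻¹ ≤ exp q := by
    rw [← inv_inv (exp q), ← Real.exp_neg]
    gcongr
  exact mul_le_mul h2 (measureReal_mono Set.inter_subset_right) measureReal_nonneg
    (Real.exp_pos _).le

/-- Second moments of projections under conditioning on a convex set. -/
lemma LogConcMeas.cond_sum_sq_le {μ : Measure (EuclideanSpace ℝ (Fin n))} [IsProbabilityMeasure μ]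
    (h : LogConcMeas μ) {p S : ℝ} (hp : 8 ≤ p) (hS : 0 < S)
    (hiso : ∀ i, ∫⁻ x, ENNReal.ofReal (x i ^ 2) ∂μ ≤ 1)
    (hσ : ∀ u : EuclideanSpace ℝ (Fin n), ‖u‖ ≤ 1 →
      ∫⁻ x, ENNReal.ofReal (|⟪u, x⟫| ^ p) ∂μ ≤ ENNReal.ofReal (S ^ p))
    {A : Set (EuclideanSpace ℝ (Fin n))} (hA : MeasurableSet A) (hAc : Convex ℝ A)
    (hμA : exp (-(2 * p)) ≤ μ.real A) (I : Finset (Fin n)) :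
    ∑ i ∈ I, ∫⁻ x, ENNReal.ofReal (x i ^ 2) ∂μ[|A] ≤
      ENNReal.ofReal (256 * radK ^ 2 * I.card + 256 * (186624 * S) ^ 2) := by
  have hA0 : μ A ≠ 0 := fun h0 => by
    simp only [Measure.real, h0, ENNReal.toReal_zero] at hμA
    exact absurd hμA (not_le.2 (Real.exp_pos _))
  have : IsProbabilityMeasure μ[|A] := cond_isProbabilityMeasure hA0
  rcases I.eq_empty_or_nonempty with rfl | hI
  · simp
  have hK : 0 < radK := by unfold radK; positivity
  set θ : ℝ := radK * √(I.card) + 186624 * S with hθ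
  have hθ0 : 0 < θ := by positivity
  have hle : μ[|A].real {x | θ < ‖coordProj I x‖} ≤ 1 / 4 := by
    calc _ ≤ exp (2 * p) * μ.real {x | θ < ‖coordProj I x‖} := cond_real_le hA hμA _
      _ ≤ exp (2 * p) * (exp (-(2 * p)) / 6) := by
          gcongr; exact h.coordProj_tail hp hS hiso hσ hI
      _ = 1 / 6 := by rw [Real.exp_neg]; field_simp
      _ ≤ _ := by norm_num
  have htail := (h.cond hA hAc).borell (coordProj I) hle
  rw [← lintegral_norm_coordProj_sq]
  have hc : Continuous fun x => ‖coordProj I x‖ := by fun_prop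
  have key := lintegral_rpow_le_of_exp_tail (ν := μ[|A]) (g := fun x => ‖coordProj I x‖)
    (D := 2) (q := 2) (β := 2 * θ) hc.measurable (fun _ => norm_nonneg _) (by norm_num)
    (by norm_num) (by positivity) (fun t _ => by
      have := htail (t / θ)
      rw [div_mul_cancel₀ _ hθ0.ne'] at this
      refine this.trans_eq ?_
      congr 2; field_simp)
  simp only [Real.rpow_two] at key
  refine key.trans (ENNReal.ofReal_le_ofReal ?_)
  have hs : √(I.card : ℝ) ^ 2 = I.card := Real.sq_sqrt (by positivity)
  have : θ ^ 2 ≤ 2 * (radK ^ 2 * I.card) + 2 * (186624 * S) ^ 2 := by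
    have e : radK ^ 2 * I.card = (radK * √(I.card)) ^ 2 := by rw [mul_pow, hs]
    rw [hθ, e]
    nlinarith [sq_nonneg (radK * √(I.card) - 186624 * S)]
  nlinarith

/-- The constant in the bound for the sum of the tail integrals. -/
def tailC : ℝ := 8 * (1024 * radK + 8192 * 512 * 186624 ^ 2 * exp 2)

lemma LogConcMeas.sum_sqrtTail_le {μ : Measure (EuclideanSpace ℝ (Fin n))} [IsProbabilityMeasure μ]
    (h : LogConcMeas μ) {p r S : ℝ} (hr : 2 ≤ r) (hp : 4 * r ≤ p) (hS : 0 < S)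
    (hSr : r ^ r * n ≤ S ^ r)
    (hiso : ∀ i, ∫⁻ x, ENNReal.ofReal (x i ^ 2) ∂μ ≤ 1)
    (hσ : ∀ u : EuclideanSpace ℝ (Fin n), ‖u‖ ≤ 1 →
      ∫⁻ x, ENNReal.ofReal (|⟪u, x⟫| ^ p) ∂μ ≤ ENNReal.ofReal (S ^ p))
    {A : Set (EuclideanSpace ℝ (Fin n))} (hA : MeasurableSet A) (hAc : Convex ℝ A)
    (hμA : exp (-(2 * p)) ≤ μ.real A) :
    ∑ i, sqrtTail μ[|A] r i ≤ ENNReal.ofReal ((tailC * S) ^ r / 4) := by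
  have hA0 : μ A ≠ 0 := fun h0 => by
    simp only [Measure.real, h0, ENNReal.toReal_zero] at hμA
    exact absurd hμA (not_le.2 (Real.exp_pos _))
  have : IsProbabilityMeasure μ[|A] := cond_isProbabilityMeasure hA0
  have hK : 0 < radK := by unfold radK; positivity
  have hsum := h.cond_sum_sq_le (by linarith) hS hiso hσ hA hAc hμA
  set a : Fin n → ℝ := fun i => (∫⁻ x, ENNReal.ofReal (x i ^ 2) ∂μ[|A]).toReal with ha
  have hfin : ∀ i, ∫⁻ x, ENNReal.ofReal (x i ^ 2) ∂μ[|A] = ENNReal.ofReal (a i) := by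
    intro i
    have := hsum {i}
    rw [Finset.sum_singleton] at this
    rw [ha, ENNReal.ofReal_toReal (ne_top_of_le_ne_top ENNReal.ofReal_ne_top this)]
  have ha0 : ∀ i, 0 ≤ a i := fun i => ENNReal.toReal_nonneg
  set I : Finset (Fin n) := {i | (32 * radK) ^ 2 < a i} with hI
  have hIsum : ∑ i ∈ I, a i ≤ 512 * (186624 * S) ^ 2 := by
    have h1 := hsum I
    simp_rw [hfin] at h1
    rw [← ENNReal.ofReal_sum_of_nonneg fun i _ => ha0 i,
      ENNReal.ofReal_le_ofReal_iff (add_nonneg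
        (mul_nonneg (by positivity) (Nat.cast_nonneg _)) (by positivity))] at h1
    have h2 : I.card * (32 * radK) ^ 2 ≤ ∑ i ∈ I, a i := by
      rw [← nsmul_eq_mul]
      refine Finset.card_nsmul_le_sum _ _ _ fun i hi => ?_
      exact (Finset.mem_filter.1 hi).2.le
    nlinarith
  have htail : ∀ i t, 0 < t → μ[|A].real {x | t < |x i|} ≤ (exp 2 * S / t) ^ p := by
    intro i t ht
    have h1 := measureReal_le_of_moment (by linarith : 0 < p) hS ht
      (hσ (EuclideanSpace.single i 1) (by simp))
    have h2 : μ.real {x | t < |x i|} ≤ (S / t) ^ p := by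
      refine le_trans (measureReal_mono fun x (hx : t < |x i|) => ?_) h1
      change t ≤ |⟪EuclideanSpace.single i (1 : ℝ), x⟫|
      rw [EuclideanSpace.inner_single_left]
      simpa using hx.le
    calc _ ≤ exp (2 * p) * μ.real {x | t < |x i|} := cond_real_le hA hμA _
      _ ≤ exp (2 * p) * (S / t) ^ p := by gcongr
      _ = _ := by
        rw [mul_div_assoc, Real.mul_rpow (Real.exp_pos _).le (by positivity), ← Real.exp_mul]
  have hlog := h.cond hA hAc
  have hsmall : ∀ i ∉ I, sqrtTail μ[|A] r i ≤ ENNReal.ofReal (2 * (16 * (32 * radK) * r) ^ r) := by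
    intro i hi
    refine hlog.sqrtTail_le_of_small (by positivity) (by linarith) ?_
    rw [hfin]
    refine ENNReal.ofReal_le_ofReal (not_lt.1 fun hlt => hi ?_)
    simp [hI, hlt]
  have hlarge : ∀ i ∈ I, sqrtTail μ[|A] r i ≤
      ENNReal.ofReal (4096 * r * (exp 2 * S) ^ (r - 2) * a i) := by
    intro i hi
    have hpos : 0 < a i := lt_of_le_of_lt (by positivity) (Finset.mem_filter.1 hi).2
    have := hlog.sqrtTail_le_of_large (Real.sqrt_pos.2 hpos) hr hp
      (mul_pos (Real.exp_pos 2) hS) (i := i) (by rw [hfin, Real.sq_sqrt hpos.le]) (htail i)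
    rwa [Real.sq_sqrt hpos.le] at this
  have hb1 : ∑ i ∈ I, sqrtTail μ[|A] r i ≤
      ENNReal.ofReal ((8192 * 512 * 186624 ^ 2 * exp 2 * S) ^ r) := by
    refine (Finset.sum_le_sum hlarge).trans ?_
    rw [← ENNReal.ofReal_sum_of_nonneg fun i _ => mul_nonneg (by positivity) (ha0 i),
      ← Finset.mul_sum]
    refine ENNReal.ofReal_le_ofReal ?_
    have he2 : 1 ≤ exp 2 := Real.one_le_exp (by norm_num)
    have hT : 0 < exp 2 * S := by positivity
    have e1 : (exp 2 * S) ^ r = (exp 2 * S) ^ (r - 2) * (exp 2 * S) ^ 2 := by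
      rw [← Real.rpow_add_natCast hT.ne']; congr 1; push_cast; ring
    have hr2 : r ≤ 2 ^ r := by
      have := one_add_mul_self_le_rpow_one_add (by norm_num : (-1 : ℝ) ≤ 1) (by linarith : 1 ≤ r)
      norm_num at this
      linarith
    have hM : (4096 * 512 * 186624 ^ 2 : ℝ) ≤ (4096 * 512 * 186624 ^ 2) ^ r :=
      Real.self_le_rpow_of_one_le (by norm_num) (by linarith)
    have e2 : (8192 * 512 * 186624 ^ 2 * exp 2 * S) ^ r =
        (4096 * 512 * 186624 ^ 2) ^ r * 2 ^ r * (exp 2 * S) ^ r := by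
      rw [← Real.mul_rpow (by norm_num) (by norm_num), ← Real.mul_rpow (by norm_num) hT.le]
      congr 1; ring
    calc 4096 * r * (exp 2 * S) ^ (r - 2) * ∑ i ∈ I, a i
        ≤ 4096 * r * (exp 2 * S) ^ (r - 2) * (512 * (186624 * S) ^ 2) := by gcongr
      _ = (4096 * 512 * 186624 ^ 2) * r * ((exp 2 * S) ^ (r - 2) * (1 * S) ^ 2) := by ring
      _ ≤ (4096 * 512 * 186624 ^ 2) * r * ((exp 2 * S) ^ (r - 2) * (exp 2 * S) ^ 2) := by gcongr
      _ = (4096 * 512 * 186624 ^ 2) * r * (exp 2 * S) ^ r := by rw [e1]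
      _ ≤ (4096 * 512 * 186624 ^ 2) ^ r * 2 ^ r * (exp 2 * S) ^ r := by gcongr
      _ = _ := e2.symm
  have hb2 : ∑ i ∈ Iᶜ, sqrtTail μ[|A] r i ≤ ENNReal.ofReal ((1024 * radK * S) ^ r) := by
    have hcard : ((Iᶜ.card : ℕ) : ℝ) ≤ n := by
      exact_mod_cast (Finset.card_le_univ _).trans_eq (Fintype.card_fin n)
    refine (Finset.sum_le_card_nsmul _ _ _ fun i hi =>
      hsmall i (Finset.mem_compl.1 hi)).trans ?_
    rw [nsmul_eq_mul, ← ENNReal.ofReal_natCast, ← ENNReal.ofReal_mul (Nat.cast_nonneg _)]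
    refine ENNReal.ofReal_le_ofReal ?_
    have h2 : (2 : ℝ) ≤ 2 ^ r := Real.self_le_rpow_of_one_le (by norm_num) (by linarith)
    calc (Iᶜ.card : ℝ) * (2 * (16 * (32 * radK) * r) ^ r)
        ≤ n * (2 ^ r * (16 * (32 * radK) * r) ^ r) := by gcongr
      _ = (1024 * radK) ^ r * (r ^ r * n) := by
          rw [Real.mul_rpow (x := 16 * (32 * radK)) (by positivity) (by positivity),
            ← mul_assoc (2 ^ r), ← Real.mul_rpow (by norm_num) (by positivity)]
          ring_nf
      _ ≤ (1024 * radK) ^ r * S ^ r := by gcongr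
      _ = _ := by rw [← Real.mul_rpow (by positivity) hS.le]
  rw [← Finset.sum_add_sum_compl I]
  refine (add_le_add hb1 hb2).trans ?_
  rw [← ENNReal.ofReal_add (by positivity) (by positivity)]
  refine ENNReal.ofReal_le_ofReal ?_
  obtain ⟨x, hx⟩ : ∃ x, x = 8192 * 512 * 186624 ^ 2 * exp 2 * S := ⟨_, rfl⟩
  obtain ⟨y, hy⟩ : ∃ y, y = 1024 * radK * S := ⟨_, rfl⟩
  have hx0 : 0 < x := by rw [hx]; positivity
  have hy0 : 0 < y := by rw [hy]; positivity
  have e : tailC * S = 8 * (x + y) := by rw [tailC, hx, hy]; ring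
  rw [e, ← hx, ← hy, Real.mul_rpow (by norm_num) (by positivity)]
  have h8 : (8 : ℝ) ≤ 8 ^ r := Real.self_le_rpow_of_one_le (by norm_num) (by linarith)
  have h1 : x ^ r ≤ (x + y) ^ r := Real.rpow_le_rpow hx0.le (by linarith) (by linarith)
  have h2 : y ^ r ≤ (x + y) ^ r := Real.rpow_le_rpow hy0.le (by linarith) (by linarith)
  have h3 : 0 < (x + y) ^ r := by positivity
  nlinarith

end Conditioning

section Stopping

variable {n : ℕ}

lemma measureReal_inter_abs_coord_le {μ : Measure (EuclideanSpace ℝ (Fin n))} [IsFiniteMeasure μ]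
    {A E : Set (EuclideanSpace ℝ (Fin n))} (hA : MeasurableSet A) (hAc : Convex ℝ A)
    (hA0 : μ A ≠ 0) {c : ℝ} (hc : 0 ≤ c)
    (hcE : ∀ B, MeasurableSet B → Convex ℝ B → μ.real (B ∩ E) ≤ c * √(μ.real B))
    (i : Fin n) (t : ℝ) :
    μ.real ((A ∩ E) ∩ {x | t < |x i|}) ≤
      2 * c * √(μ.real A) * √(μ[|A].real {x | t < |x i|}) := by
  set H : Set (EuclideanSpace ℝ (Fin n)) := {x | t < |x i|} with hH
  have hcm : Continuous fun x : EuclideanSpace ℝ (Fin n) => x i := by fun_prop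
  have hlin : IsLinearMap ℝ fun x : EuclideanSpace ℝ (Fin n) => x i :=
    ⟨fun _ _ => rfl, fun _ _ => rfl⟩
  have half : ∀ B : Set (EuclideanSpace ℝ (Fin n)), B ⊆ H → MeasurableSet B → Convex ℝ B →
      μ.real ((A ∩ B) ∩ E) ≤ c * √(μ.real (A ∩ H)) := by
    intro B hB hBm hBc
    refine (hcE _ (hA.inter hBm) (hAc.inter hBc)).trans ?_
    gcongr
    finiteness
  have h1 := half {x | t < x i} (fun x (hx : t < x i) => hx.trans_le (le_abs_self _))
    (measurableSet_lt measurable_const hcm.measurable) (convex_halfSpace_gt hlin t)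
  have h2 := half {x | x i < -t} (fun x (hx : x i < -t) => lt_abs.2 (Or.inr (lt_neg_of_lt_neg hx)))
    (measurableSet_lt hcm.measurable measurable_const) (convex_halfSpace_lt hlin (-t))
  have h3 : μ.real ((A ∩ E) ∩ H) ≤
      μ.real ((A ∩ {x | t < x i}) ∩ E) + μ.real ((A ∩ {x | x i < -t}) ∩ E) := by
    refine (measureReal_mono ?_).trans (measureReal_union_le _ _)
    rintro x ⟨⟨hxA, hxE⟩, hx⟩
    rcases lt_abs.1 (show t < |x i| from hx) with hx | hx
    · exact Or.inl ⟨⟨hxA, hx⟩, hxE⟩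
    · exact Or.inr ⟨⟨hxA, lt_neg_of_lt_neg hx⟩, hxE⟩
  have h4 : μ.real (A ∩ H) = μ.real A * μ[|A].real H := by
    have hA' : (μ A).toReal ≠ 0 := (measureReal_ne_zero_iff (by finiteness)).2 hA0
    rw [Measure.real, Measure.real, Measure.real, cond_apply hA, ENNReal.toReal_mul,
      ENNReal.toReal_inv, mul_inv_cancel_left₀ hA']
  rw [h4, Real.sqrt_mul measureReal_nonneg] at h1 h2
  linarith

lemma measureReal_inter_le_half {μ : Measure (EuclideanSpace ℝ (Fin n))} [IsFiniteMeasure μ]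
    {A E : Set (EuclideanSpace ℝ (Fin n))} (hA : MeasurableSet A) (hAc : Convex ℝ A)
    (hA0 : μ A ≠ 0) {c r Θ : ℝ} (hc : 0 ≤ c) (hr : 0 < r) (hΘ : 0 < Θ) (hE : MeasurableSet E)
    (hEΘ : ∀ x ∈ E, Θ ≤ ∑ i, |x i| ^ r)
    (hcE : ∀ B, MeasurableSet B → Convex ℝ B → μ.real (B ∩ E) ≤ c * √(μ.real B))
    (hsum : ∑ i, sqrtTail μ[|A] r i ≤ ENNReal.ofReal (Θ / 4)) :
    μ.real (A ∩ E) ≤ c / 2 * √(μ.real A) := by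
  have hAE := hA.inter hE
  set K : ℝ := 2 * c * √(μ.real A) with hK
  have hK0 : 0 ≤ K := by positivity
  have hi : ∀ i, ∫⁻ x in A ∩ E, ENNReal.ofReal (|x i| ^ r) ∂μ ≤
      ENNReal.ofReal K * sqrtTail μ[|A] r i := by
    intro i
    have hcm : Continuous fun x : EuclideanSpace ℝ (Fin n) => |x i| := by fun_prop
    rw [lintegral_rpow_eq_lintegral_meas_lt_mul _
      (Filter.Eventually.of_forall fun _ => abs_nonneg _) hcm.aemeasurable hr, sqrtTail,
      mul_left_comm,
      ← lintegral_const_mul' (ENNReal.ofReal K) _ ENNReal.ofReal_ne_top]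
    gcongr ENNReal.ofReal r * ?_
    refine lintegral_mono fun t => ?_
    rw [← mul_assoc, ← ENNReal.ofReal_mul hK0]
    gcongr
    rw [Measure.restrict_apply (measurableSet_lt measurable_const hcm.measurable), Set.inter_comm,
      ← ofReal_measureReal]
    exact ENNReal.ofReal_le_ofReal (measureReal_inter_abs_coord_le hA hAc hA0 hc hcE i t)
  have hmain : ENNReal.ofReal Θ * μ (A ∩ E) ≤ ENNReal.ofReal (K * (Θ / 4)) := by
    calc ENNReal.ofReal Θ * μ (A ∩ E) = ∫⁻ _ in A ∩ E, ENNReal.ofReal Θ ∂μ := by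
          rw [setLIntegral_const]
      _ ≤ ∫⁻ x in A ∩ E, ∑ i, ENNReal.ofReal (|x i| ^ r) ∂μ := by
          refine setLIntegral_mono (by fun_prop) fun x hx => ?_
          rw [← ENNReal.ofReal_sum_of_nonneg fun _ _ => by positivity]
          exact ENNReal.ofReal_le_ofReal (hEΘ x hx.2)
      _ = ∑ i, ∫⁻ x in A ∩ E, ENNReal.ofReal (|x i| ^ r) ∂μ :=
          lintegral_finsetSum _ fun i _ => by fun_prop
      _ ≤ ∑ i, ENNReal.ofReal K * sqrtTail μ[|A] r i := Finset.sum_le_sum fun i _ => hi i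
      _ ≤ ENNReal.ofReal (K * (Θ / 4)) := by
          rw [← Finset.mul_sum, ENNReal.ofReal_mul hK0]
          gcongr
  have h2 := ENNReal.toReal_mono ENNReal.ofReal_ne_top hmain
  rw [ENNReal.toReal_mul, ENNReal.toReal_ofReal hΘ.le, ENNReal.toReal_ofReal (by positivity)] at h2
  refine le_of_mul_le_mul_left (h2.trans_eq ?_) hΘ
  rw [hK]
  ring

/-- If every convex set of measure at least `exp (-2p)` has small tail integrals, then the sum of
the `r`-th powers of the coordinates is large with probability at most `exp (-p)`. -/
lemma measureReal_le_exp_of_sum_sqrtTail_le {μ : Measure (EuclideanSpace ℝ (Fin n))}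
    [IsProbabilityMeasure μ] {E : Set (EuclideanSpace ℝ (Fin n))} {p r Θ : ℝ}
    (hr : 0 < r) (hΘ : 0 < Θ) (hE : MeasurableSet E) (hEΘ : ∀ x ∈ E, Θ ≤ ∑ i, |x i| ^ r)
    (hsum : ∀ A, MeasurableSet A → Convex ℝ A → exp (-(2 * p)) ≤ μ.real A →
      ∑ i, sqrtTail μ[|A] r i ≤ ENNReal.ofReal (Θ / 4)) :
    μ.real E ≤ exp (-p) := by
  have claim : ∀ k : ℕ, ∀ A, MeasurableSet A → Convex ℝ A →
      μ.real (A ∩ E) ≤ (exp (-p) + (1 / 2) ^ k) * √(μ.real A) := by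
    intro k
    induction k with
    | zero =>
      intro A _ _
      have h1 : μ.real A ≤ √(μ.real A) := Real.le_sqrt_of_sq_le
        (by nlinarith [measureReal_nonneg (μ := μ) (s := A), measureReal_le_one (μ := μ) (s := A)])
      have h2 : μ.real (A ∩ E) ≤ μ.real A := measureReal_mono Set.inter_subset_left
      nlinarith [mul_nonneg (Real.exp_pos (-p)).le (Real.sqrt_nonneg (μ.real A))]
    | succ k ih =>
      intro A hA hAc
      rcases le_or_gt (exp (-(2 * p))) (μ.real A) with hμ | hμ
      · have hA0 : μ A ≠ 0 := (measureReal_ne_zero_iff (by finiteness)).1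
          ((Real.exp_pos _).trans_le hμ).ne'
        refine (measureReal_inter_le_half hA hAc hA0 (by positivity) hr hΘ hE hEΘ ih
          (hsum A hA hAc hμ)).trans ?_
        gcongr
        rw [pow_succ]
        linarith [Real.exp_pos (-p)]
      · have h1 : √(μ.real A) ≤ exp (-p) := by
          rw [Real.sqrt_le_left (Real.exp_pos _).le, sq, ← Real.exp_add]
          refine hμ.le.trans_eq ?_
          ring_nf
        calc μ.real (A ∩ E) ≤ μ.real A := measureReal_mono Set.inter_subset_left
          _ = √(μ.real A) * √(μ.real A) := (Real.mul_self_sqrt measureReal_nonneg).symm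
          _ ≤ (exp (-p) + (1 / 2) ^ (k + 1)) * √(μ.real A) := by
            gcongr
            exact h1.trans (le_add_of_nonneg_right (by positivity))
  have hlim : Filter.Tendsto (fun k : ℕ => exp (-p) + (1 / 2 : ℝ) ^ k) Filter.atTop
      (nhds (exp (-p) + 0)) :=
    (tendsto_pow_atTop_nhds_zero_of_lt_one (by norm_num) (by norm_num)).const_add _
  rw [add_zero] at hlim
  refine ge_of_tendsto' hlim fun k => ?_
  simpa using claim k Set.univ MeasurableSet.univ convex_univ

end Stopping

section Isotropic

variable {n : ℕ}

lemma IsIsotropic.integrable_sq {μ : Measure Ω} {X : Ω → EuclideanSpace ℝ (Fin n)}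
    (h : IsIsotropic μ X) (i : Fin n) : Integrable (fun ω => X ω i ^ 2) μ := by
  by_contra hn
  have h1 := h.2 i i
  simp_rw [← sq] at h1
  rw [integral_undef hn] at h1
  simp at h1

lemma IsIsotropic.memLp {μ : Measure Ω} {X : Ω → EuclideanSpace ℝ (Fin n)} (hX : Measurable X)
    (h : IsIsotropic μ X) (i : Fin n) : MemLp (fun ω => X ω i) 2 μ :=
  (memLp_two_iff_integrable_sq (by fun_prop)).2 (h.integrable_sq i)

lemma IsIsotropic.lintegral_inner_sq {μ : Measure Ω} {X : Ω → EuclideanSpace ℝ (Fin n)}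
    (hX : Measurable X) (h : IsIsotropic μ X) (u : EuclideanSpace ℝ (Fin n)) :
    ∫⁻ ω, ENNReal.ofReal (⟪u, X ω⟫ ^ 2) ∂μ = ENNReal.ofReal (‖u‖ ^ 2) := by
  have h_int : ∀ i j, Integrable (fun ω => u i * u j * (X ω i * X ω j)) μ := fun i j =>
    ((h.memLp hX i).integrable_mul (h.memLp hX j)).const_mul _
  have e : ∀ ω, ⟪u, X ω⟫ ^ 2 = ∑ i, ∑ j, u i * u j * (X ω i * X ω j) := by
    intro ω
    rw [PiLp.inner_apply, sq, Finset.sum_mul_sum]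
    refine Finset.sum_congr rfl fun i _ => Finset.sum_congr rfl fun j _ => ?_
    simp only [RCLike.inner_apply, conj_trivial]
    ring
  have hI : Integrable (fun ω => ⟪u, X ω⟫ ^ 2) μ := by
    simp_rw [e]
    exact integrable_finsetSum _ fun i _ => integrable_finsetSum _ fun j _ => h_int i j
  rw [← ofReal_integral_eq_lintegral_ofReal hI (Filter.Eventually.of_forall fun _ => sq_nonneg _)]
  congr 1
  simp_rw [e]
  rw [integral_finsetSum _ fun i _ => integrable_finsetSum _ fun j _ => h_int i j]
  simp_rw [integral_finsetSum _ fun j _ => h_int _ j, integral_const_mul, h.2]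
  rw [EuclideanSpace.norm_sq_eq]
  refine Finset.sum_congr rfl fun i _ => ?_
  simp [sq]

lemma IsIsotropic.lintegral_coord_sq {μ : Measure Ω} {X : Ω → EuclideanSpace ℝ (Fin n)}
    (hX : Measurable X) (h : IsIsotropic μ X) (i : Fin n) :
    ∫⁻ x, ENNReal.ofReal (x i ^ 2) ∂μ.map X = 1 := by
  rw [lintegral_map (by fun_prop) hX]
  have := h.lintegral_inner_sq hX (EuclideanSpace.single i 1)
  simpa [EuclideanSpace.inner_single_left] using this

lemma IsIsotropic.lintegral_inner_rpow_le {μ : Measure Ω} [IsProbabilityMeasure μ]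
    {X : Ω → EuclideanSpace ℝ (Fin n)} (hX : Measurable X) (h : IsIsotropic μ X)
    (hlc : IsLogConcave μ X) {q : ℝ} (hq : 1 ≤ q) {u : EuclideanSpace ℝ (Fin n)} (hu : ‖u‖ ≤ 1) :
    ∫⁻ x, ENNReal.ofReal (|⟪u, x⟫| ^ q) ∂μ.map X ≤ ENNReal.ofReal ((16 * q) ^ q) := by
  have : IsProbabilityMeasure (μ.map X) := Measure.isProbabilityMeasure_map hX.aemeasurable
  have key := (hlc.logConcMeas hX).moment_le (innerSL ℝ u) (b := 1) one_pos (by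
    simp only [innerSL_apply_apply, Real.norm_eq_abs, sq_abs]
    rw [lintegral_map (by fun_prop) hX, h.lintegral_inner_sq hX]
    exact ENNReal.ofReal_le_ofReal (by gcongr)) hq
  simpa only [innerSL_apply_apply, Real.norm_eq_abs, mul_one] using key

lemma IsIsotropic.lintegral_inner_rpow_le_sigmaX {μ : Measure Ω} [IsProbabilityMeasure μ]
    {X : Ω → EuclideanSpace ℝ (Fin n)} (hX : Measurable X) (h : IsIsotropic μ X)
    (hlc : IsLogConcave μ X) {q : ℝ} (hq : 1 ≤ q) {u : EuclideanSpace ℝ (Fin n)} (hu : ‖u‖ = 1) :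
    ∫⁻ x, ENNReal.ofReal (|⟪u, x⟫| ^ q) ∂μ.map X ≤ ENNReal.ofReal (sigmaX μ X q ^ q) := by
  have hq0 : 0 < q := by linarith
  have hfin : ∀ v : EuclideanSpace ℝ (Fin n), ‖v‖ = 1 →
      ∫⁻ ω, ENNReal.ofReal (|⟪v, X ω⟫| ^ q) ∂μ ≤ ENNReal.ofReal ((16 * q) ^ q) := by
    intro v hv
    have := h.lintegral_inner_rpow_le hX hlc hq hv.le
    rwa [lintegral_map (by fun_prop) hX] at this
  have h_int : ∀ v : EuclideanSpace ℝ (Fin n), ‖v‖ = 1 →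
      ∫⁻ ω, ENNReal.ofReal (|⟪v, X ω⟫| ^ q) ∂μ = ENNReal.ofReal (∫ ω, |⟪v, X ω⟫| ^ q ∂μ) := by
    intro v hv
    have hnn : 0 ≤ᵐ[μ] fun ω => |⟪v, X ω⟫| ^ q :=
      Filter.Eventually.of_forall fun ω => by positivity
    have hm : AEStronglyMeasurable (fun ω => |⟪v, X ω⟫| ^ q) μ :=
      Measurable.aestronglyMeasurable (by fun_prop)
    rw [integral_eq_lintegral_of_nonneg_ae hnn hm,
      ENNReal.ofReal_toReal (ne_top_of_le_ne_top ENNReal.ofReal_ne_top (hfin v hv))]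
  have hbdd : BddAbove (Set.range fun v : {v : EuclideanSpace ℝ (Fin n) // ‖v‖ = 1} =>
      (∫ ω, |⟪v.1, X ω⟫| ^ q ∂μ) ^ (1 / q)) := by
    refine ⟨16 * q, ?_⟩
    rintro _ ⟨v, rfl⟩
    have h1 := hfin v.1 v.2
    rw [h_int v.1 v.2, ENNReal.ofReal_le_ofReal_iff (by positivity)] at h1
    have h0 : 0 ≤ ∫ ω, |⟪v.1, X ω⟫| ^ q ∂μ := integral_nonneg fun ω => by positivity
    calc (∫ ω, |⟪v.1, X ω⟫| ^ q ∂μ) ^ (1 / q) ≤ ((16 * q) ^ q) ^ (1 / q) := by gcongr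
      _ = 16 * q := by rw [one_div, Real.rpow_rpow_inv (by positivity) hq0.ne']
  rw [lintegral_map (by fun_prop) hX, h_int u hu]
  refine ENNReal.ofReal_le_ofReal ?_
  have h0 : 0 ≤ ∫ ω, |⟪u, X ω⟫| ^ q ∂μ := integral_nonneg fun ω => by positivity
  have h2 : (∫ ω, |⟪u, X ω⟫| ^ q ∂μ) ^ (1 / q) ≤ sigmaX μ X q := le_ciSup hbdd ⟨u, hu⟩
  calc ∫ ω, |⟪u, X ω⟫| ^ q ∂μ = ((∫ ω, |⟪u, X ω⟫| ^ q ∂μ) ^ (1 / q)) ^ q := by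
        rw [one_div, Real.rpow_inv_rpow h0 hq0.ne']
    _ ≤ _ := by gcongr

lemma lintegral_inner_rpow_le_of_unit {ν : Measure (EuclideanSpace ℝ (Fin n))} {p S : ℝ}
    (hp : 0 < p)
    (h : ∀ u : EuclideanSpace ℝ (Fin n), ‖u‖ = 1 →
      ∫⁻ x, ENNReal.ofReal (|⟪u, x⟫| ^ p) ∂ν ≤ ENNReal.ofReal (S ^ p))
    {u : EuclideanSpace ℝ (Fin n)} (hu : ‖u‖ ≤ 1) :
    ∫⁻ x, ENNReal.ofReal (|⟪u, x⟫| ^ p) ∂ν ≤ ENNReal.ofReal (S ^ p) := by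
  rcases eq_or_ne u 0 with rfl | hu0
  · simp [Real.zero_rpow hp.ne']
  have hpos : 0 < ‖u‖ := norm_pos_iff.2 hu0
  refine le_trans (lintegral_mono fun x => ENNReal.ofReal_le_ofReal ?_)
    (h (‖u‖⁻¹ • u) (by rw [norm_smul, norm_inv, norm_norm, inv_mul_cancel₀ hpos.ne']))
  refine Real.rpow_le_rpow (abs_nonneg _) ?_ hp.le
  rw [real_inner_smul_left, abs_mul, abs_of_pos (inv_pos.2 hpos)]
  exact le_mul_of_one_le_left (abs_nonneg _) ((one_le_inv₀ hpos).2 hu)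

lemma tailC_pos : 0 < tailC := by
  have : 0 < radK := by unfold radK; positivity
  unfold tailC
  positivity

/-- The tail estimate at a single level `q` with `σ_X(q) ≤ s`. -/
lemma IsIsotropic.lrNorm_tail {μ : Measure Ω} [IsProbabilityMeasure μ]
    {X : Ω → EuclideanSpace ℝ (Fin n)} (hX : Measurable X) (h : IsIsotropic μ X)
    (hlc : IsLogConcave μ X) {q r s : ℝ} (hr : 2 ≤ r) (hrs : r ≤ s) (hn : r ^ r * n ≤ s ^ r)
    (hq : 1 ≤ q) (hqs : sigmaX μ X q ≤ s) :
    μ.real {ω | 64 * tailC * s ≤ lrNorm r (X ω)} ≤ exp (-q) := by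
  have : IsProbabilityMeasure (μ.map X) := Measure.isProbabilityMeasure_map hX.aemeasurable
  have hC := tailC_pos
  have hs : 0 < s := by linarith
  obtain ⟨p, hqp, hrp, hσ⟩ : ∃ p, q ≤ p ∧ 4 * r ≤ p ∧
      ∀ u : EuclideanSpace ℝ (Fin n), ‖u‖ = 1 →
        ∫⁻ x, ENNReal.ofReal (|⟪u, x⟫| ^ p) ∂μ.map X ≤ ENNReal.ofReal ((64 * s) ^ p) := by
    rcases le_total q (4 * r) with hle | hle
    · refine ⟨4 * r, hle, le_rfl, fun u hu => ?_⟩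
      refine (h.lintegral_inner_rpow_le hX hlc (by linarith) hu.le).trans
        (ENNReal.ofReal_le_ofReal ?_)
      exact Real.rpow_le_rpow (by positivity) (by linarith) (by linarith)
    · refine ⟨q, le_rfl, hle, fun u hu => ?_⟩
      refine (h.lintegral_inner_rpow_le_sigmaX hX hlc hq hu).trans (ENNReal.ofReal_le_ofReal ?_)
      have h0 : 0 ≤ sigmaX μ X q := Real.iSup_nonneg fun v =>
        Real.rpow_nonneg (integral_nonneg fun ω => by positivity) _
      exact Real.rpow_le_rpow h0 (by linarith) (by linarith)
  set E : Set (EuclideanSpace ℝ (Fin n)) := {x | 64 * tailC * s ≤ lrNorm r x} with hE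
  have hEm : MeasurableSet E := by
    refine measurableSet_le measurable_const ?_
    unfold lrNorm
    fun_prop
  have hEΘ : ∀ x ∈ E, (tailC * (64 * s)) ^ r ≤ ∑ i, |x i| ^ r := by
    intro x hx
    have hx' : tailC * (64 * s) ≤ (∑ i, |x i| ^ r) ^ (1 / r) := by
      refine le_trans (le_of_eq ?_) hx
      ring
    have h0 : 0 ≤ ∑ i, |x i| ^ r := Finset.sum_nonneg fun i _ => by positivity
    calc (tailC * (64 * s)) ^ r ≤ ((∑ i, |x i| ^ r) ^ (1 / r)) ^ r :=
          Real.rpow_le_rpow (by positivity) hx' (by linarith)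
      _ = _ := by rw [one_div, Real.rpow_inv_rpow h0 (by linarith)]
  have hSr : r ^ r * n ≤ (64 * s) ^ r :=
    hn.trans (Real.rpow_le_rpow hs.le (by linarith) (by linarith))
  have key := measureReal_le_exp_of_sum_sqrtTail_le (μ := μ.map X) (p := p) (r := r)
    (by linarith) (Real.rpow_pos_of_pos (by positivity) _) hEm hEΘ fun A hA hAc hμA =>
      (hlc.logConcMeas hX).sum_sqrtTail_le hr hrp (by positivity) hSr
        (fun i => (h.lintegral_coord_sq hX i).le)
        (fun u hu => lintegral_inner_rpow_le_of_unit (by linarith) hσ hu) hA hAc hμA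
  rw [map_measureReal_apply hX hEm] at key
  exact key.trans (Real.exp_le_exp.2 (by linarith))

end Isotropic

/-- There is a universal constant `C > 0` such that for every `r ≥ 2`, every isotropic
log-concave random vector `X` in `ℝⁿ` and every `t ≥ 1`,
`P(‖X‖_r ≥ C·t·r·n^(1/r)) ≤ exp(−σ_X⁻¹(t·r·n^(1/r)))`. -/
theorem lr_tail :
    ∃ C : ℝ, 0 < C ∧
      ∀ (Ω : Type) (_ : MeasurableSpace Ω) (μ : Measure Ω), IsProbabilityMeasure μ →
      ∀ (n : ℕ) (r : ℝ), 2 ≤ r →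
      ∀ X : Ω → EuclideanSpace ℝ (Fin n), Measurable X →
      IsLogConcave μ X → IsIsotropic μ X →
      ∀ t : ℝ, 1 ≤ t →
        (μ {ω | C * t * r * (n : ℝ) ^ (1 / r) ≤ lrNorm r (X ω)}).toReal ≤
          Real.exp (-(sigmaXInv μ X (t * r * (n : ℝ) ^ (1 / r)))) := by
  refine ⟨64 * tailC, by linarith [tailC_pos], ?_⟩
  intro Ω _ μ _ n r hr X hX hlc hiso t ht
  set s : ℝ := t * r * (n : ℝ) ^ (1 / r) with hs
  have e : 64 * tailC * t * r * (n : ℝ) ^ (1 / r) = 64 * tailC * s := by rw [hs]; ring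
  rw [e]
  change μ.real {ω | 64 * tailC * s ≤ lrNorm r (X ω)} ≤ _
  rcases Nat.eq_zero_or_pos n with rfl | hn
  · have hempty : IsEmpty {v : EuclideanSpace ℝ (Fin 0) // ‖v‖ = 1} :=
      ⟨fun v => by simpa [Subsingleton.elim v.1 0] using v.2⟩
    have hs0 : s = 0 := by
      rw [hs, Nat.cast_zero, Real.zero_rpow (by positivity), mul_zero]
    have hinv : sigmaXInv μ X s = 0 := by
      refine Real.sSup_of_not_bddAbove fun ⟨b, hb⟩ => ?_
      have := hb (a := max 1 (b + 1)) ⟨le_max_left _ _, by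
        rw [hs0, sigmaX, Real.iSup_of_isEmpty]⟩
      linarith [le_max_right 1 (b + 1)]
    rw [hinv, neg_zero, Real.exp_zero]
    exact measureReal_le_one
  have hr0 : 0 < r := by linarith
  have hn1 : (1 : ℝ) ≤ n := by exact_mod_cast hn
  have hroot : 1 ≤ (n : ℝ) ^ (1 / r) := Real.one_le_rpow hn1 (by positivity)
  have htr : r ≤ t * r := le_mul_of_one_le_left hr0.le ht
  have hrs : r ≤ s := htr.trans (le_mul_of_one_le_right (by linarith) hroot)
  have hns : r ^ r * n ≤ s ^ r := by
    rw [hs, Real.mul_rpow (by linarith) (by linarith), one_div, Real.rpow_inv_rpow (by positivity)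
      hr0.ne']
    gcongr
  have hlevel : ∀ q ∈ {q : ℝ | 1 ≤ q ∧ sigmaX μ X q ≤ s},
      μ.real {ω | 64 * tailC * s ≤ lrNorm r (X ω)} ≤ exp (-q) := fun q hq =>
    hiso.lrNorm_tail hX hlc hr hrs hns hq.1 hq.2
  rcases (measureReal_nonneg (μ := μ)
    (s := {ω | 64 * tailC * s ≤ lrNorm r (X ω)})).eq_or_lt with h0 | h0
  · rw [← h0]
    exact (Real.exp_pos _).le
  rw [← Real.log_le_iff_le_exp h0, le_neg]
  refine Real.sSup_le (fun q hq => ?_) ?_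
  · rw [le_neg, Real.log_le_iff_le_exp h0]
    exact hlevel q hq
  · exact neg_nonneg.2 (Real.log_nonpos h0.le measureReal_le_one)

end
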